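/- arXiv:1410.8179 — 2 statements merged into one kernel-verified Lean document; each statement's English description precedes it below -/
import Mathlib

section
/- Let (r_j) be a sequence of reals tending to +∞, let (ω_j) be positive reals with ω_j · log(r_j) / log(log(r_j)) → 0, and let (r'_j), (r''_j) be sequences of reals satisfying |r'_j − r_j| < ω_j and |r''_j − r_j| < ω_j for all j. Then the quantity ζ(1 + 2ir'_j) ζ(1 − 2ir''_j) Γ(1/2 + ir'_j) Γ(1/2 − ir''_j) / [ζ(1 + 2ir''_j) ζ(1 − 2ir'_j) Γ(1/2 + ir''_j) Γ(1/2 − ir'_j)] − exp(2i (r'_j − r''_j) log r_j) tends to 0 as j → ∞. -/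
open Complex Filter Topology

noncomputable def ee (x : ℝ) : ℂ := cexp (2 * Real.pi * x * I)

lemma ee_norm (x : ℝ) : ‖ee x‖ = 1 := by
  have : ee x = cexp ((2 * Real.pi * x : ℝ) * I) := by simp [ee]
  rw [this, Complex.norm_exp_ofReal_mul_I]

lemma ee_add (x y : ℝ) : ee (x + y) = ee x * ee y := by
  rw [ee, ee, ee, ← Complex.exp_add]; push_cast; ring_nf

lemma ee_conj (x : ℝ) : (starRingEnd ℂ) (ee x) = ee (-x) := by
  rw [ee, ee, ← Complex.exp_conj]; simp [map_ofNat]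

lemma ee_neg_norm_sum (a : ℕ → ℝ) (M : ℕ) :
    ‖∑ n ∈ Finset.range M, ee (-(a n))‖ = ‖∑ n ∈ Finset.range M, ee (a n)‖ := by
  rw [← Complex.norm_conj (∑ n ∈ Finset.range M, ee (a n)), map_sum]
  simp [ee_conj]

/-- The coefficient. -/
noncomputable def kc (θ : ℝ) : ℂ := 1 / 2 + (Real.cot (Real.pi * θ) / 2 : ℝ) * I

lemma kc_spec (θ : ℝ) (h0 : 0 < θ) (h1 : θ ≤ 1 / 2) : kc θ * (1 - ee θ) = 1 := by
  have hs : 0 < Real.sin (Real.pi * θ) := by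
    apply Real.sin_pos_of_pos_of_lt_pi
    · positivity
    · nlinarith [Real.pi_pos]
  have he : ee θ = (Real.cos (Real.pi * θ) + Real.sin (Real.pi * θ) * I) ^ 2 := by
    rw [ee]
    rw [Complex.ofReal_cos, Complex.ofReal_sin, ← Complex.exp_mul_I, ← Complex.exp_nat_mul]
    push_cast; ring_nf
  rw [kc, he, Real.cot_eq_cos_div_sin]
  set c := Real.cos (Real.pi * θ)
  set s := Real.sin (Real.pi * θ)
  have hcs : c ^ 2 + s ^ 2 = 1 := Real.cos_sq_add_sin_sq _
  have hs' : (s : ℂ) ≠ 0 := by exact_mod_cast hs.ne'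
  have hcs' : (c : ℂ) ^ 2 + s ^ 2 = 1 := by exact_mod_cast hcs
  push_cast
  field_simp
  have hI : I ^ 2 = -1 := Complex.I_sq
  have hI3 : I ^ 3 = -I := by rw [pow_succ, hI]; ring
  ring_nf
  rw [hI, hI3]
  linear_combination (I * c - s) * (-1) * hcs'

lemma kc_norm (θ : ℝ) (h0 : 0 < θ) (h1 : θ ≤ 1 / 2) : ‖kc θ‖ ≤ 1 / 2 + 1 / (4 * θ) ∧
    0 ≤ Real.cot (Real.pi * θ) ∧ Real.cot (Real.pi * θ) ≤ 1 / (2 * θ) := by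
  have hj : 2 * θ ≤ Real.sin (Real.pi * θ) := by
    have := Real.mul_le_sin (x := Real.pi * θ) (by positivity) (by nlinarith [Real.pi_pos])
    have h2 : 2 / Real.pi * (Real.pi * θ) = 2 * θ := by field_simp
    linarith
  have hc : 0 ≤ Real.cos (Real.pi * θ) := by
    apply Real.cos_nonneg_of_neg_pi_div_two_le_of_le <;> nlinarith [Real.pi_pos]
  have hc0 : 0 ≤ Real.cot (Real.pi * θ) := by
    rw [Real.cot_eq_cos_div_sin]; apply div_nonneg hc; linarith
  have hc1 : Real.cot (Real.pi * θ) ≤ 1 / (2 * θ) := by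
    rw [Real.cot_eq_cos_div_sin]
    exact div_le_div₀ zero_le_one (Real.cos_le_one _) (by positivity) hj
  refine ⟨?_, hc0, hc1⟩
  rw [kc]
  refine (norm_add_le _ _).trans ?_
  rw [norm_mul, Complex.norm_I, Complex.norm_real, Real.norm_of_nonneg (by positivity)]
  have : 1 / (4 * θ) = (1 / (2 * θ)) / 2 := by field_simp; norm_num
  rw [this]
  have h12 : ‖(1 / 2 : ℂ)‖ = 1 / 2 := by norm_num
  rw [h12]
  linarith

lemma cot_anti (x y : ℝ) (h0 : 0 < x) (hxy : x ≤ y) (h1 : y ≤ 1 / 2) :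
    Real.cot (Real.pi * y) ≤ Real.cot (Real.pi * x) := by
  have hpi := Real.pi_pos
  have hs1 : 0 < Real.sin (Real.pi * x) :=
    Real.sin_pos_of_pos_of_lt_pi (by positivity) (by nlinarith)
  have hs2 : 0 < Real.sin (Real.pi * y) :=
    Real.sin_pos_of_pos_of_lt_pi (mul_pos hpi (by linarith)) (by nlinarith)
  rw [Real.cot_eq_cos_div_sin, Real.cot_eq_cos_div_sin, div_le_div_iff₀ hs2 hs1]
  have : 0 ≤ Real.sin (Real.pi * y - Real.pi * x) :=
    Real.sin_nonneg_of_nonneg_of_le_pi (by nlinarith) (by nlinarith)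
  rw [Real.sin_sub] at this
  nlinarith

lemma kusmin_landau (a : ℕ → ℝ) (M : ℕ) (lam : ℝ) (hl : 0 < lam)
    (h1 : ∀ n < M, lam ≤ a (n + 1) - a n ∧ a (n + 1) - a n ≤ 1 / 2)
    (h2 : ∀ n < M, a (n + 2) - a (n + 1) ≤ a (n + 1) - a n) :
    ‖∑ n ∈ Finset.range M, ee (a n)‖ ≤ 2 / lam := by
  rcases Nat.eq_zero_or_pos M with rfl | hM
  · simp; positivity
  set θ : ℕ → ℝ := fun n => a (n + 1) - a n with hθ
  have key : ∀ m, m < M → ‖∑ n ∈ Finset.range (m + 1), ee (a n) + kc (θ m) * ee (a (m + 1))‖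
      ≤ ‖kc (θ 0)‖ + (Real.cot (Real.pi * θ m) - Real.cot (Real.pi * θ 0)) / 2 := by
    intro m
    have hstep : ∀ m < M, ee (a m) + kc (θ m) * ee (a (m + 1)) = kc (θ m) * ee (a m) := by
      intro m hm
      have hsp := kc_spec (θ m) (hl.trans_le (h1 m hm).1) (h1 m hm).2
      have : ee (a (m + 1)) = ee (θ m) * ee (a m) := by
        rw [← ee_add]; congr 1; simp [hθ]
      rw [this]
      linear_combination (-ee (a m)) * hsp
    induction m with
    | zero =>
      intro hm
      simp only [zero_add, Finset.sum_range_one, sub_self, zero_div, add_zero]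
      rw [hstep 0 hm, norm_mul, ee_norm, mul_one]
    | succ m ih =>
      intro hm
      have ih' := ih (by omega)
      rw [Finset.sum_range_succ, add_assoc, hstep (m + 1) hm]
      have e1 : ∑ n ∈ Finset.range (m + 1), ee (a n) + kc (θ (m + 1)) * ee (a (m + 1)) =
        (∑ n ∈ Finset.range (m + 1), ee (a n) + kc (θ m) * ee (a (m + 1)))
          + (kc (θ (m + 1)) - kc (θ m)) * ee (a (m + 1)) := by ring
      rw [e1]
      refine (norm_add_le _ _).trans ?_
      have hc := cot_anti (θ (m + 1)) (θ m) (hl.trans_le (h1 _ hm).1) (h2 m (by omega))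
        (h1 m (by omega)).2
      have e2 : kc (θ (m + 1)) - kc (θ m) =
        (((Real.cot (Real.pi * θ (m + 1)) - Real.cot (Real.pi * θ m)) / 2 : ℝ) : ℂ) * I := by
        rw [kc, kc]; push_cast; ring
      have e3 : ‖(kc (θ (m + 1)) - kc (θ m)) * ee (a (m + 1))‖ =
          (Real.cot (Real.pi * θ (m + 1)) - Real.cot (Real.pi * θ m)) / 2 := by
        rw [e2, norm_mul, norm_mul, ee_norm, Complex.norm_I, Complex.norm_real,
          Real.norm_of_nonneg (by linarith)]; ring
      rw [e3]; linarith
  obtain ⟨m, rfl⟩ : ∃ m, M = m + 1 := ⟨M - 1, by omega⟩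
  have hk := key m (by omega)
  have b0 := kc_norm (θ 0) (hl.trans_le (h1 0 (by omega)).1) (h1 0 (by omega)).2
  have bm := kc_norm (θ m) (hl.trans_le (h1 m (by omega)).1) (h1 m (by omega)).2
  have t0 : 1 / (4 * θ 0) ≤ 1 / (4 * lam) :=
    one_div_le_one_div_of_le (by positivity) (by linarith [(h1 0 (by omega)).1])
  have tm : 1 / (4 * θ m) ≤ 1 / (4 * lam) :=
    one_div_le_one_div_of_le (by positivity) (by linarith [(h1 m (by omega)).1])
  have tm2 : 1 / (2 * θ m) ≤ 1 / (2 * lam) :=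
    one_div_le_one_div_of_le (by positivity) (by linarith [(h1 m (by omega)).1])
  have hle : lam ≤ 1 / 2 := (h1 0 (by omega)).1.trans (h1 0 (by omega)).2
  have : ∑ n ∈ Finset.range (m + 1), ee (a n) =
    (∑ n ∈ Finset.range (m + 1), ee (a n) + kc (θ m) * ee (a (m + 1)))
      - kc (θ m) * ee (a (m + 1)) := by ring
  rw [this]
  refine (norm_sub_le _ _).trans ?_
  rw [norm_mul (kc _), ee_norm, mul_one]
  have f1 : 1 / (4 * lam) = (1 / lam) / 4 := by field_simp
  have f2 : 1 / (2 * lam) = (1 / lam) / 2 := by field_simp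
  have f3 : 2 / lam = 2 * (1 / lam) := by ring
  have f4 : 2 ≤ 1 / lam := by rw [le_div_iff₀ hl]; linarith
  linarith [b0.2.1, bm.2.2, b0.1, bm.1]

lemma vdc_shift (g : ℤ → ℂ) (M H k : ℕ) (hk : k < H) (hg : ∀ n, n < 0 ∨ (M : ℤ) ≤ n → g n = 0) :
    ∑ m ∈ Finset.Ico (0 : ℤ) (M + H), g (m - k) = ∑ n ∈ Finset.Ico (0 : ℤ) M, g n := by
  have h1 : ∑ m ∈ Finset.Ico (0 : ℤ) (M + H), g (m - k) =
      ∑ n ∈ (Finset.Ico (0 : ℤ) (M + H)).image (fun m => m - (k : ℤ)), g n := by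
    rw [Finset.sum_image]
    intro x _ y _ h; simpa using h
  rw [h1]
  symm
  apply Finset.sum_subset
  · intro n hn
    simp only [Finset.mem_Ico, Finset.mem_image] at hn ⊢
    exact ⟨n + k, by omega, by ring⟩
  · intro n _ hn
    apply hg
    simp only [Finset.mem_Ico] at hn
    omega

lemma vdc (z : ℕ → ℂ) (M N H : ℕ) (hMN : M ≤ N) (hH : 1 ≤ H) (hHN : H ≤ N) :
    ‖∑ n ∈ Finset.range M, z n‖ ^ 2 ≤ (4 * N / H : ℝ) *
      ∑ h ∈ Finset.range H, ‖∑ n ∈ Finset.range (M - h), z (n + h) * (starRingEnd ℂ) (z n)‖ := by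
  set w : ℤ → ℂ := fun n => if 0 ≤ n ∧ n < M then z n.toNat else 0 with hw
  have hw0 : ∀ n, n < 0 ∨ (M : ℤ) ≤ n → w n = 0 := by
    intro n hn; simp only [hw]; rw [if_neg]; omega
  set τ : ℕ → ℝ := fun h => ‖∑ n ∈ Finset.range (M - h), z (n + h) * (starRingEnd ℂ) (z n)‖ with hτ
  set S := ∑ n ∈ Finset.range M, z n with hS
  have hzS : ∀ G : ℤ → ℂ, ∀ K : ℕ, ∑ n ∈ Finset.Ico (0 : ℤ) K, G n = ∑ n ∈ Finset.range K, G n := by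
    intro G K
    symm
    apply Finset.sum_nbij (fun n : ℕ => (n : ℤ))
    · intro n hn; simp at hn ⊢; omega
    · intro a _ b _ h; simpa using h
    · intro n hn; simp at hn ⊢; exact ⟨n.toNat, by omega, by omega⟩
    · intro n _; rfl
  have hSw : ∑ n ∈ Finset.Ico (0 : ℤ) M, w n = S := by
    rw [hzS]
    apply Finset.sum_congr rfl
    intro n hn
    simp only [Finset.mem_range] at hn
    simp [hw, hn]
  -- correlation
  have hT : ∀ k l : ℕ, k ≤ l → ‖∑ n ∈ Finset.Ico (0 : ℤ) M, w n * (starRingEnd ℂ) (w (n - ((l : ℤ) - k)))‖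
      = τ (l - k) := by
    intro k l hkl
    obtain ⟨d, rfl⟩ : ∃ d, l = k + d := ⟨l - k, by omega⟩
    simp only [hτ]
    congr 1
    rw [hzS]
    have e : k + d - k = d := by omega
    rw [e]
    rcases le_total M d with h | h
    · have : M - d = 0 := by omega
      rw [this]
      simp only [Finset.range_zero, Finset.sum_empty]
      apply Finset.sum_eq_zero
      intro n hn
      simp only [Finset.mem_range] at hn
      rw [hw0 (n - _) (by left; push_cast; omega)]; simp
    · obtain ⟨M', rfl⟩ : ∃ M', M = d + M' := ⟨M - d, by omega⟩
      rw [Finset.sum_range_add]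
      have z0 : ∑ x ∈ Finset.range d, w x * (starRingEnd ℂ) (w (x - (((k + d : ℕ) : ℤ) - k))) = 0 := by
        apply Finset.sum_eq_zero
        intro n hn
        simp only [Finset.mem_range] at hn
        rw [hw0 (n - _) (by left; push_cast; omega)]; simp
      rw [z0, zero_add]
      have : d + M' - d = M' := by omega
      rw [this]
      apply Finset.sum_congr rfl
      intro n hn
      simp only [Finset.mem_range] at hn
      have e1 : (((d + n : ℕ) : ℤ) - (((k + d : ℕ) : ℤ) - k)) = n := by push_cast; ring
      rw [e1]
      have e2 : w ((d + n : ℕ) : ℤ) = z (n + d) := by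
        simp only [hw]; rw [if_pos (by omega)]; congr 1; omega
      have e3 : w (n : ℤ) = z n := by
        simp only [hw]; rw [if_pos (by omega)]; congr 1
      rw [e2, e3]
  have hC : ∀ k < H, ∀ l < H, k ≤ l →
      ‖∑ m ∈ Finset.Ico (0 : ℤ) (M + H), w (m - k) * (starRingEnd ℂ) (w (m - l))‖ = τ (l - k) := by
    intro k hk l hl hkl
    rw [← hT k l hkl, ← vdc_shift _ M H k hk]
    · congr 1; apply Finset.sum_congr rfl; intro m _; congr 3; ring
    · intro n hn; rw [hw0 n hn]; simp
  have hC2 : ∀ k < H, ∀ l < H,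
      ‖∑ m ∈ Finset.Ico (0 : ℤ) (M + H), w (m - k) * (starRingEnd ℂ) (w (m - l))‖ ≤
        (if k ≤ l then τ (l - k) else 0) + (if l ≤ k then τ (k - l) else 0) := by
    intro k hk l hl
    have hτ0 : ∀ h, 0 ≤ τ h := fun h => norm_nonneg _
    rcases le_total k l with h | h
    · rw [hC k hk l hl h, if_pos h]
      split_ifs <;> simp [hτ0]
    · rw [← Complex.norm_conj, map_sum]
      have := hC l hl k hk h
      simp only [map_mul, Complex.conj_conj]
      simp_rw [mul_comm ((starRingEnd ℂ) _)]
      rw [this, if_pos h]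
      split_ifs <;> simp [hτ0]
  have hHS : (H : ℂ) * S = ∑ m ∈ Finset.Ico (0 : ℤ) (M + H), ∑ k ∈ Finset.range H, w (m - k) := by
    rw [Finset.sum_comm]
    rw [Finset.sum_congr rfl (fun k hk => vdc_shift w M H k (Finset.mem_range.mp hk) hw0), hSw]
    simp
  have hcs : ‖(H : ℂ) * S‖ ^ 2 ≤ (M + H) *
      ∑ m ∈ Finset.Ico (0 : ℤ) (M + H), ‖∑ k ∈ Finset.range H, w (m - k)‖ ^ 2 := by
    rw [hHS]
    refine (pow_le_pow_left₀ (norm_nonneg _) (norm_sum_le _ _) 2).trans ?_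
    refine (sq_sum_le_card_mul_sum_sq).trans ?_
    have hc : ((Finset.Ico (0 : ℤ) (M + H)).card : ℝ) = M + H := by
      rw [Int.card_Ico]
      have : ((M : ℤ) + H - 0).toNat = M + H := by omega
      rw [this]; push_cast; rfl
    rw [hc]
  have hexp : ((∑ m ∈ Finset.Ico (0 : ℤ) (M + H), ‖∑ k ∈ Finset.range H, w (m - k)‖ ^ 2 : ℝ) : ℂ) =
      ∑ k ∈ Finset.range H, ∑ l ∈ Finset.range H,
        ∑ m ∈ Finset.Ico (0 : ℤ) (M + H), w (m - k) * (starRingEnd ℂ) (w (m - l)) := by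
    push_cast
    have : ∀ m : ℤ, ((‖∑ k ∈ Finset.range H, w (m - k)‖ : ℂ)) ^ 2 = ∑ k ∈ Finset.range H, ∑ l ∈ Finset.range H,
        w (m - k) * (starRingEnd ℂ) (w (m - l)) := by
      intro m
      rw [← Complex.mul_conj', map_sum, Finset.sum_mul_sum]
    simp_rw [this]
    rw [Finset.sum_comm]
    apply Finset.sum_congr rfl; intro k _
    rw [Finset.sum_comm]
  have hin : ∀ k < H, ∑ l ∈ Finset.range H, ((if k ≤ l then τ (l - k) else 0) + (if l ≤ k then τ (k - l) else 0))
      ≤ 2 * ∑ h ∈ Finset.range H, τ h := by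
    intro k hk
    have hτ0 : ∀ h, 0 ≤ τ h := fun h => norm_nonneg _
    rw [Finset.sum_add_distrib, two_mul]
    apply add_le_add
    · rw [← Finset.sum_filter]
      rw [← Finset.sum_image (f := τ) (g := fun l => l - k)]
      · apply Finset.sum_le_sum_of_subset_of_nonneg
        · intro x hx; simp at hx ⊢; omega
        · intros; apply hτ0
      · intro x hx y hy h; simp at hx hy h; omega
    · rw [← Finset.sum_filter]
      rw [← Finset.sum_image (f := τ) (g := fun l => k - l)]
      · apply Finset.sum_le_sum_of_subset_of_nonneg
        · intro x hx; simp at hx ⊢; omega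
        · intros; apply hτ0
      · intro x hx y hy h; simp at hx hy h; omega
  have hfin : ∑ m ∈ Finset.Ico (0 : ℤ) (M + H), ‖∑ k ∈ Finset.range H, w (m - k)‖ ^ 2 ≤
      H * (2 * ∑ h ∈ Finset.range H, τ h) := by
    have h0 : 0 ≤ ∑ m ∈ Finset.Ico (0 : ℤ) (M + H), ‖∑ k ∈ Finset.range H, w (m - k)‖ ^ 2 := by positivity
    rw [← Real.norm_of_nonneg h0, ← Complex.norm_real, hexp]
    refine (norm_sum_le _ _).trans ?_
    calc _ ≤ ∑ k ∈ Finset.range H, (2 * ∑ h ∈ Finset.range H, τ h) := by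
          apply Finset.sum_le_sum
          intro k hk
          refine (norm_sum_le _ _).trans ?_
          refine le_trans ?_ (hin k (Finset.mem_range.mp hk))
          apply Finset.sum_le_sum
          intro l hl
          exact hC2 k (Finset.mem_range.mp hk) l (Finset.mem_range.mp hl)
      _ = _ := by simp
  have hHpos : (0 : ℝ) < H := by exact_mod_cast hH
  have h2N : (M + H : ℝ) ≤ 2 * N := by
    have : M + H ≤ 2 * N := by omega
    exact_mod_cast this
  have hSig : 0 ≤ ∑ h ∈ Finset.range H, τ h := Finset.sum_nonneg (fun h _ => norm_nonneg _)
  have hall : (H : ℝ) ^ 2 * ‖S‖ ^ 2 ≤ (2 * N) * (H * (2 * ∑ h ∈ Finset.range H, τ h)) := by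
    have e : (H : ℝ) ^ 2 * ‖S‖ ^ 2 = ‖(H : ℂ) * S‖ ^ 2 := by
      rw [norm_mul, Complex.norm_natCast]; ring
    rw [e]
    refine hcs.trans ?_
    gcongr
  rw [div_mul_eq_mul_div, le_div_iff₀ hHpos]
  nlinarith

lemma fwd_shift (a : ℕ → ℝ) (h i n : ℕ) :
    (fwdDiff 1)^[i] (fun m => a (m + h) - a m) n =
      (fwdDiff 1)^[i] a (n + h) - (fwdDiff 1)^[i] a n := by
  induction i generalizing n with
  | zero => simp
  | succ i ih =>
    rw [Function.iterate_succ_apply', Function.iterate_succ_apply', fwdDiff, fwdDiff, fwdDiff, ih, ih]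
    have : n + 1 + h = n + h + 1 := by ring
    rw [this]; ring

lemma fwd_shift_sum (a : ℕ → ℝ) (h i n : ℕ) :
    (fwdDiff 1)^[i] (fun m => a (m + h) - a m) n =
      ∑ l ∈ Finset.range h, (fwdDiff 1)^[i + 1] a (n + l) := by
  rw [fwd_shift]
  have := Finset.sum_range_sub (fun l => (fwdDiff 1)^[i] a (n + l)) h
  simp only [add_zero] at this
  rw [← this]
  apply Finset.sum_congr rfl
  intro l _
  rw [Function.iterate_succ_apply', fwdDiff]
  rfl

lemma weyl (N H : ℕ) (hH : 1 ≤ H) (hHN : H ≤ N) (L : ℝ) (hL1 : 1 ≤ L)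
    (hL : ∑ h ∈ Finset.range H, (1 : ℝ) / h ≤ L) (i : ℕ) :
    ∀ (a : ℕ → ℝ) (M : ℕ) (lam U : ℝ), M ≤ N → 0 < lam → U * H ^ i ≤ 1 / 2 →
    (∀ n < M, lam ≤ (fwdDiff 1)^[i + 1] a n ∧ (fwdDiff 1)^[i + 1] a n ≤ U) →
    (∀ n < M, (fwdDiff 1)^[i + 2] a n ≤ 0) →
    (‖∑ n ∈ Finset.range M, ee (a n)‖ / N) ^ (2 ^ i) ≤
      16 ^ (2 ^ i) * (1 / H + L ^ i / (N * lam * H ^ i)) := by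
  have hHpos : (0 : ℝ) < H := by exact_mod_cast hH
  have hNpos : (0 : ℝ) < N := by exact_mod_cast (by omega : 0 < N)
  induction i with
  | zero =>
    intro a M lam U hM hl hU h1 h2
    simp only [pow_zero, pow_one, mul_one] at *
    have := kusmin_landau a M lam hl ?_ ?_
    · calc ‖∑ n ∈ Finset.range M, ee (a n)‖ / N ≤ (2 / lam) / N := by gcongr
        _ = 2 * (1 / (N * lam)) := by field_simp
        _ ≤ 16 * (1 / H + 1 / (N * lam)) := by
          have h3 : 0 < 1 / (H : ℝ) := by positivity
          have h4 : 0 < 1 / (N * lam) := by positivity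
          linarith
    · intro n hn
      have := h1 n hn
      simp only [zero_add, Function.iterate_one, fwdDiff] at this
      exact ⟨this.1, this.2.trans hU⟩
    · intro n hn
      have := h2 n hn
      simp only [zero_add, Function.iterate_succ, Function.iterate_zero, Function.comp, id, fwdDiff] at this
      linarith
  | succ i ih =>
    intro a M lam U hM hl hU h1 h2
    set P := 2 ^ i with hP
    have hP1 : 1 ≤ P := Nat.one_le_two_pow
    set s := ‖∑ n ∈ Finset.range M, ee (a n)‖ / N with hs
    set σ : ℕ → ℝ := fun h => ‖∑ n ∈ Finset.range (M - h), ee (a (n + h) - a n)‖ / N with hσ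
    have hσ0 : ∀ h, 0 ≤ σ h := fun h => by positivity
    have hU0 : M = 0 ∨ 0 < U := by
      rcases Nat.eq_zero_or_pos M with h | h
      · left; exact h
      · right; exact hl.trans_le ((h1 0 h).1.trans (h1 0 h).2)
    set X := L ^ i / (N * lam * H ^ i) with hX
    have hX0 : 0 < X := by positivity
    have hσb : ∀ h, 1 ≤ h → h < H → σ h ^ P ≤ 16 ^ P * (1 / H + X * (1 / h)) := by
      intro h hh1 hhH
      have hhpos : (0 : ℝ) < h := by exact_mod_cast hh1
      rcases Nat.eq_zero_or_pos M with h0 | h0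
      · have : σ h = 0 := by simp [hσ, h0]
        rw [this, zero_pow (by omega)]; positivity
      have hUp : 0 < U := hU0.resolve_left (by omega)
      have := ih (fun n => a (n + h) - a n) (M - h) (h * lam) (h * U) (by omega) (by positivity) ?_ ?_ ?_
      · refine this.trans (le_of_eq ?_)
        congr 2
        rw [hX]; field_simp
      · calc (h : ℝ) * U * H ^ i ≤ H * U * H ^ i := by
              have : (h : ℝ) ≤ H := by exact_mod_cast hhH.le
              gcongr
          _ = U * H ^ (i + 1) := by ring
          _ ≤ 1 / 2 := hU
      · intro n hn
        rw [fwd_shift_sum]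
        constructor
        · calc (h : ℝ) * lam = ∑ l ∈ Finset.range h, lam := by simp
            _ ≤ _ := Finset.sum_le_sum (fun l hl => (h1 (n + l) (by
                have := Finset.mem_range.mp hl; omega)).1)
        · calc _ ≤ ∑ l ∈ Finset.range h, U := Finset.sum_le_sum (fun l hl => (h1 (n + l) (by
                have := Finset.mem_range.mp hl; omega)).2)
            _ = _ := by simp
      · intro n hn
        rw [fwd_shift_sum]
        exact Finset.sum_nonpos (fun l hl => h2 (n + l) (by
                have := Finset.mem_range.mp hl; omega))
    have hv := vdc (fun n => ee (a n)) M N H hM hH hHN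
    have hcorr : ∀ h, ‖∑ n ∈ Finset.range (M - h), ee (a (n + h)) * (starRingEnd ℂ) (ee (a n))‖ = N * σ h := by
      intro h
      simp only [hσ]
      rw [mul_div_cancel₀ _ hNpos.ne']
      congr 1
      apply Finset.sum_congr rfl
      intro n _
      rw [ee_conj, ← ee_add, sub_eq_add_neg]
    simp only [hcorr] at hv
    have hσz : σ 0 ≤ 1 := by
      simp only [hσ]
      rw [div_le_one hNpos]
      refine (norm_sum_le _ _).trans ?_
      simp only [ee_norm]
      simp
      exact hM
    have hs2 : s ^ 2 ≤ (4 / H) * ∑ h ∈ Finset.range H, σ h := by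
      rw [hs, div_pow, div_le_iff₀ (by positivity)]
      refine hv.trans (le_of_eq ?_)
      rw [← Finset.mul_sum]; ring
    have hpow : (s ^ 2) ^ P ≤ 4 ^ P * ((∑ h ∈ Finset.range H, σ h ^ P) / H) := by
      refine (pow_le_pow_left₀ (by positivity) hs2 P).trans ?_
      obtain ⟨p, hp⟩ : ∃ p, P = p + 1 := ⟨P - 1, by omega⟩
      rw [hp]
      have hj := pow_sum_div_card_le_sum_pow (s := Finset.range H) (f := σ) (fun i _ => hσ0 i) p
      rw [Finset.card_range] at hj
      calc (4 / H * ∑ h ∈ Finset.range H, σ h) ^ (p + 1)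
          = 4 ^ (p + 1) * (((∑ h ∈ Finset.range H, σ h) ^ (p + 1) / H ^ p) / H) := by
            rw [mul_pow, div_pow, pow_succ (H : ℝ)]; field_simp
        _ ≤ _ := by gcongr
    have hsum : ∑ h ∈ Finset.range H, σ h ^ P ≤ 1 + 16 ^ P * (1 + X * L) := by
      obtain ⟨H', rfl⟩ : ∃ H', H = H' + 1 := ⟨H - 1, by omega⟩
      rw [Finset.sum_range_succ'] at hL ⊢
      simp only [Nat.cast_zero, div_zero, add_zero] at hL
      have : σ 0 ^ P ≤ 1 := pow_le_one₀ (hσ0 0) hσz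
      have h3 : ∑ k ∈ Finset.range H', σ (k + 1) ^ P ≤
          ∑ k ∈ Finset.range H', 16 ^ P * (1 / ((H' + 1 : ℕ) : ℝ) + X * (1 / ((k + 1 : ℕ) : ℝ))) := by
        apply Finset.sum_le_sum
        intro k hk
        have := Finset.mem_range.mp hk
        exact hσb (k + 1) (by omega) (by omega)
      rw [← Finset.mul_sum, Finset.sum_add_distrib, ← Finset.mul_sum] at h3
      have h4 : ∑ k ∈ Finset.range H', 1 / ((H' + 1 : ℕ) : ℝ) ≤ 1 := by
        simp
        rw [← div_eq_mul_inv, div_le_one (by positivity)]; linarith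
      have h5 : X * ∑ k ∈ Finset.range H', 1 / ((k + 1 : ℕ) : ℝ) ≤ X * L := by gcongr
      have h6 : (0 : ℝ) < 16 ^ P := by positivity
      nlinarith
    have h16 : (1 : ℝ) ≤ 16 ^ P := one_le_pow₀ (by norm_num)
    calc s ^ (2 ^ (i + 1)) = (s ^ 2) ^ P := by rw [← pow_mul, hP]; congr 1; ring
      _ ≤ 4 ^ P * ((∑ h ∈ Finset.range H, σ h ^ P) / H) := hpow
      _ ≤ 4 ^ P * ((1 + 16 ^ P * (1 + X * L)) / H) := by gcongr
      _ ≤ 4 ^ P * ((2 * 16 ^ P * (1 + X * L)) / H) := by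
        have : 0 < X * L := by positivity
        gcongr
        nlinarith
      _ ≤ 4 ^ P * ((2 ^ P * 16 ^ P * (1 + X * L)) / H) := by
        have : 0 < X * L := by positivity
        have : (2 : ℝ) ≤ 2 ^ P := by
          calc (2 : ℝ) = 2 ^ 1 := by norm_num
            _ ≤ 2 ^ P := pow_le_pow_right₀ (by norm_num) hP1
        gcongr
      _ = (8 ^ P * 16 ^ P) * (1 / H + X * L / H) := by
        have : (8 : ℝ) ^ P = 4 ^ P * 2 ^ P := by rw [← mul_pow]; norm_num
        rw [this]; field_simp
      _ ≤ (16 ^ P * 16 ^ P) * (1 / H + X * L / H) := by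
        have : 0 < X * L := by positivity
        gcongr
        norm_num
      _ = 16 ^ (2 ^ (i + 1)) * (1 / H + L ^ (i + 1) / (N * lam * H ^ (i + 1))) := by
        rw [← pow_add, hX, hP]
        congr 2
        · ring
        · field_simp; ring

lemma fwd_log_deriv (i : ℕ) : ∀ x : ℝ, 0 < x → HasDerivAt ((fwdDiff 1)^[i] Real.log)
    ((-1) ^ i * i.factorial / ∏ l ∈ Finset.range (i + 1), (x + l)) x := by
  induction i with
  | zero => intro x hx; simpa using Real.hasDerivAt_log hx.ne'
  | succ i ih =>
    intro x hx
    rw [Function.iterate_succ']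
    have h1 := (ih (x + 1) (by positivity)).comp_add_const x 1
    have h2 := ih x hx
    have h3 := h1.sub h2
    refine h3.congr_deriv ?_
    have hp : ∀ m : ℕ, 0 < ∏ l ∈ Finset.range m, (x + 1 + l) := fun m =>
      Finset.prod_pos (fun l _ => by positivity)
    have e1 : ∏ l ∈ Finset.range (i + 1), (x + l) = x * ∏ l ∈ Finset.range i, (x + 1 + l) := by
      rw [Finset.prod_range_succ']
      push_cast
      rw [mul_comm]; congr 1
      · simp
      · apply Finset.prod_congr rfl; intro l _; ring
    have e2 : ∏ l ∈ Finset.range (i + 1 + 1), (x + l) = x * ∏ l ∈ Finset.range (i + 1), (x + 1 + l) := by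
      rw [Finset.prod_range_succ']
      push_cast
      rw [mul_comm]; congr 1
      · simp
      · apply Finset.prod_congr rfl; intro l _; ring
    rw [e1, e2, Finset.prod_range_succ (fun l : ℕ => x + 1 + (l : ℝ)) i]
    have := hp i
    have hxi : (x + 1 + i : ℝ) ≠ 0 := by positivity
    rw [Nat.factorial_succ]
    push_cast
    field_simp
    ring

lemma fwd_log_bound (i : ℕ) (x : ℝ) (hx : 0 < x) :
    i.factorial / (x + i + 1) ^ (i + 1) ≤ (-1) ^ i * (fwdDiff 1)^[i + 1] Real.log x ∧
    (-1) ^ i * (fwdDiff 1)^[i + 1] Real.log x ≤ i.factorial / x ^ (i + 1) := by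
  obtain ⟨ξ, hξ, he⟩ := exists_hasDerivAt_eq_slope ((fwdDiff 1)^[i] Real.log)
    (fun x => (-1) ^ i * i.factorial / ∏ l ∈ Finset.range (i + 1), (x + l)) (by linarith : x < x + 1)
    (fun y hy => (fwd_log_deriv i y (by linarith [hy.1])).continuousAt.continuousWithinAt)
    (fun y hy => fwd_log_deriv i y (by linarith [hy.1]))
  have hF : (fwdDiff 1)^[i + 1] Real.log x =
      (-1) ^ i * i.factorial / ∏ l ∈ Finset.range (i + 1), (ξ + l) := by
    rw [Function.iterate_succ_apply', fwdDiff, he]; simp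
  have hξ0 : 0 < ξ := by linarith [hξ.1]
  have hpos : 0 < ∏ l ∈ Finset.range (i + 1), (ξ + l) :=
      Finset.prod_pos (fun l _ => by positivity)
  have e : (-1) ^ i * (fwdDiff 1)^[i + 1] Real.log x =
      i.factorial / ∏ l ∈ Finset.range (i + 1), (ξ + l) := by
    rw [hF, ← mul_div_assoc, ← mul_assoc, ← mul_pow]; norm_num
  rw [e]
  constructor
  · apply div_le_div_of_nonneg_left (by positivity) hpos
    calc ∏ l ∈ Finset.range (i + 1), (ξ + l) ≤ ∏ l ∈ Finset.range (i + 1), (x + i + 1) := by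
          apply Finset.prod_le_prod
          · intro l _; positivity
          · intro l hl
            have : (l : ℝ) ≤ i := by exact_mod_cast (by have := Finset.mem_range.mp hl; omega)
            linarith [hξ.2]
      _ = _ := by simp
  · apply div_le_div_of_nonneg_left (by positivity) (by positivity)
    calc x ^ (i + 1) = ∏ l ∈ Finset.range (i + 1), x := by simp
      _ ≤ _ := by
          apply Finset.prod_le_prod
          · intro l _; positivity
          · intro l hl
            have : (0 : ℝ) ≤ l := by positivity
            linarith [hξ.1]

lemma fwd_nat (f : ℝ → ℝ) (c : ℝ) (N i n : ℕ) :
    (fwdDiff 1)^[i] (fun n : ℕ => c * f (N + n)) n = c * (fwdDiff 1)^[i] f (N + n) := by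
  induction i generalizing n with
  | zero => simp
  | succ i ih =>
    rw [Function.iterate_succ_apply', Function.iterate_succ_apply', fwdDiff, fwdDiff, ih, ih]
    push_cast
    rw [← add_assoc]; ring

lemma weyl_log (N H M i : ℕ) (t : ℝ) (ht : 0 < t) (hH : 1 ≤ H) (hHN : H ≤ N) (L : ℝ) (hL1 : 1 ≤ L)
    (hL : ∑ h ∈ Finset.range H, (1 : ℝ) / h ≤ L) (hM : M ≤ N) (hi : i + 1 ≤ N)
    (hU : t / (2 * Real.pi) * (i.factorial / N ^ (i + 1)) * H ^ i ≤ 1 / 2) :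
    (‖∑ n ∈ Finset.range M, ee (t / (2 * Real.pi) * Real.log (N + n))‖ / N) ^ (2 ^ i) ≤
      16 ^ (2 ^ i) * (1 / H + L ^ i / (N * (t / (2 * Real.pi) * (i.factorial / (3 * N) ^ (i + 1))) * H ^ i)) := by
  have hpi := Real.pi_pos
  have hNpos : (0 : ℝ) < N := by exact_mod_cast (by omega : 0 < N)
  set c := t / (2 * Real.pi) with hc
  have hcp : 0 < c := by positivity
  have hn : ‖∑ n ∈ Finset.range M, ee (c * Real.log (N + n))‖ =
      ‖∑ n ∈ Finset.range M, ee (((-1) ^ i * c) * Real.log (N + n))‖ := by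
    rcases neg_one_pow_eq_or ℝ i with h | h
    · rw [h]; simp
    · rw [h, ← ee_neg_norm_sum]; simp
  rw [hn]
  apply weyl N H hH hHN L hL1 hL i (fun n : ℕ => ((-1) ^ i * c) * Real.log (N + n)) M _ _ hM
    (by positivity) hU
  · intro n hn
    rw [fwd_nat]
    have hx : (0 : ℝ) < N + n := by positivity
    have := fwd_log_bound i (N + n) hx
    have e : (-1) ^ i * c * (fwdDiff 1)^[i + 1] Real.log (N + n) =
      c * ((-1) ^ i * (fwdDiff 1)^[i + 1] Real.log (N + n)) := by ring
    rw [e]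
    constructor
    · refine mul_le_mul_of_nonneg_left (le_trans ?_ this.1) hcp.le
      have : (N + n + i + 1 : ℝ) ≤ 3 * N := by
        have : N + n + i + 1 ≤ 3 * N := by omega
        exact_mod_cast this
      gcongr
    · refine mul_le_mul_of_nonneg_left (le_trans this.2 ?_) hcp.le
      gcongr
      simp
  · intro n hn
    rw [fwd_nat]
    have hx : (0 : ℝ) < N + n := by positivity
    have := (fwd_log_bound (i + 1) (N + n) hx).1
    have h0 : 0 ≤ (-1) ^ (i + 1) * (fwdDiff 1)^[i + 1 + 1] Real.log ((N : ℝ) + n) := le_trans (by positivity) this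
    rw [pow_succ] at h0
    have : (-1) ^ i * c * (fwdDiff 1)^[i + 2] Real.log (N + n) =
      - (c * ((-1) ^ i * -1 * (fwdDiff 1)^[i + 1 + 1] Real.log ((N : ℝ) + n))) := by ring
    rw [this]
    have := mul_nonneg hcp.le h0
    linarith

lemma harm_sum_le (H : ℕ) (hH : 1 ≤ H) : ∑ h ∈ Finset.range H, (1 : ℝ) / h ≤ 1 + Real.log H := by
  have h1 := harmonic_le_one_add_log H
  obtain ⟨H', rfl⟩ : ∃ H', H = H' + 1 := ⟨H - 1, by omega⟩
  rw [Finset.sum_range_succ']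
  simp only [Nat.cast_zero, div_zero, add_zero]
  refine le_trans ?_ h1
  rw [harmonic, Finset.sum_range_succ]
  push_cast
  have : (0 : ℝ) ≤ ((H' : ℝ) + 1)⁻¹ := by positivity
  simp only [one_div]
  linarith

set_option maxHeartbeats 1000000 in
lemma block (k N M : ℕ) (t : ℝ) (hk : 1 ≤ k) (ht : 0 < t) (hM : M ≤ N)
    (hN1 : Real.log t ≤ k * Real.log N) (hN2 : Real.log N ≤ 2 * Real.log t)
    (hbig : 60000 * (k : ℝ) ^ 2 ≤ Real.log N) :
    ‖∑ n ∈ Finset.range M, ee (t / (2 * Real.pi) * Real.log (N + n))‖ ≤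
      48 * N * Real.exp (-(Real.log N) / (8 * 4 ^ k)) := by
  set l := Real.log N with hl
  set T := Real.log t with hT
  have hk1 : (1 : ℝ) ≤ k := by exact_mod_cast hk
  have hl6 : 60000 ≤ l := by nlinarith
  have hN0 : 0 < N := by
    rcases Nat.eq_zero_or_pos N with h | h
    · rw [h] at hl; simp at hl; linarith
    · exact h
  have hNpos : (0 : ℝ) < N := by exact_mod_cast hN0
  have hNe : (N : ℝ) = Real.exp l := by rw [hl, Real.exp_log hNpos]
  have hte : t = Real.exp T := by rw [hT, Real.exp_log ht]
  set q := 2 * T / l - 1 / 2 with hq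
  have hq0 : 0 ≤ q := by
    have : 1 ≤ 2 * T / l := by rw [le_div_iff₀ (by linarith)]; linarith
    rw [hq]; linarith
  set i := ⌊q⌋₊ with hi
  have hi1 : (i : ℝ) ≤ q := Nat.floor_le hq0
  have hi2 : q < i + 1 := Nat.lt_floor_add_one q
  have hTq : 2 * T = (q + 1 / 2) * l := by rw [hq]; field_simp; ring
  have hTlow : (i / 2 + 1 / 4) * l ≤ T := by nlinarith
  have hThigh : T ≤ (i / 2 + 3 / 4) * l := by nlinarith
  have hik : (i : ℝ) ≤ 2 * k := by
    have : q + 1 / 2 ≤ 2 * k := by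
      have h3 : (q + 1 / 2) * l ≤ (2 * k) * l := by linarith
      exact le_of_mul_le_mul_right h3 (by linarith)
    linarith
  have hikn : i ≤ 2 * k := by exact_mod_cast hik
  set H := Nat.sqrt N with hH
  have hH1 : 1 ≤ H := by rw [hH, Nat.one_le_iff_ne_zero]; intro h; rw [Nat.sqrt_eq_zero] at h; omega
  have hHN : H ≤ N := Nat.sqrt_le_self N
  have hHpos : (0 : ℝ) < H := by exact_mod_cast hH1
  have hexp2 : Real.exp (l / 2) ^ 2 = N := by rw [← Real.exp_nat_mul, hNe]; congr 1; push_cast; ring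
  have hHup : (H : ℝ) ≤ Real.exp (l / 2) := by
    rw [← sq_le_sq₀ hHpos.le (Real.exp_pos _).le]
    rw [hexp2]
    exact_mod_cast Nat.sqrt_le' N
  have hHlow : Real.exp (l / 2) ≤ 2 * H := by
    rw [← sq_le_sq₀ (Real.exp_pos _).le (by positivity)]
    rw [hexp2]
    have h1 : N < (H + 1) ^ 2 := Nat.lt_succ_sqrt' N
    have h2 : N ≤ (2 * H) ^ 2 := h1.le.trans (Nat.pow_le_pow_left (by omega) 2)
    exact_mod_cast h2
  have hfac : (i.factorial : ℝ) ≤ Real.exp (l / 4) := by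
    calc (i.factorial : ℝ) ≤ (i : ℝ) ^ i := by exact_mod_cast Nat.factorial_le_pow i
      _ ≤ (Real.exp i) ^ i := by
        gcongr
        linarith [Real.add_one_le_exp (i : ℝ)]
      _ = Real.exp (i * i) := by rw [← Real.exp_nat_mul]
      _ ≤ Real.exp (l / 4) := by
        apply Real.exp_le_exp.mpr
        have : (i : ℝ) * i ≤ (2 * k) * (2 * k) := by gcongr
        nlinarith
  have hfac1 : (1 : ℝ) ≤ i.factorial := by exact_mod_cast Nat.one_le_iff_ne_zero.mpr (Nat.factorial_ne_zero i)
  have hiN : i + 1 ≤ N := by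
    have : (i + 1 : ℝ) ≤ N := by
      rw [hNe]
      have := Real.add_one_le_exp l
      nlinarith
    exact_mod_cast this
  have hpi := Real.pi_pos
  have hpi3 := Real.pi_gt_three
  have hpi4 := Real.pi_lt_four
  have hpi315 := Real.pi_lt_d2
  have hU : t / (2 * Real.pi) * (i.factorial / N ^ (i + 1)) * H ^ i ≤ 1 / 2 := by
    calc t / (2 * Real.pi) * (i.factorial / N ^ (i + 1)) * H ^ i
        ≤ t / (2 * Real.pi) * (Real.exp (l / 4) / N ^ (i + 1)) * (Real.exp (l / 2)) ^ i := by gcongr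
      _ = 1 / (2 * Real.pi) * Real.exp (T + l / 4 - (i + 1) * l + i * (l / 2)) := by
        rw [hte, hNe, ← Real.exp_nat_mul, ← Real.exp_nat_mul, Real.exp_add, Real.exp_sub, Real.exp_add]
        push_cast; ring
      _ ≤ 1 / (2 * Real.pi) * 1 := by
        gcongr
        rw [Real.exp_le_one_iff]
        nlinarith
      _ ≤ 1 / 2 := by rw [mul_one]; apply one_div_le_one_div_of_le <;> linarith
  have hL : ∑ h ∈ Finset.range H, (1 : ℝ) / h ≤ 1 + l := by
    refine (harm_sum_le H hH1).trans ?_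
    have : Real.log H ≤ l := Real.log_le_log hHpos (by exact_mod_cast hHN)
    linarith
  have hmain := weyl_log N H M i t ht hH1 hHN (1 + l) (by linarith) hL hM hiN hU
  set s := ‖∑ n ∈ Finset.range M, ee (t / (2 * Real.pi) * Real.log (N + n))‖ / N with hs
  have h6L : 6 * (1 + l) ≤ Real.exp (l / (32 * k)) := by
    have h1 := Real.quadratic_le_exp_of_nonneg (x := l / (32 * k)) (by positivity)
    have h2 : 29 * l ≤ (l / (32 * k)) ^ 2 / 2 := by
      rw [div_pow, div_div, le_div_iff₀ (by positivity)]
      have h4 := mul_le_mul_of_nonneg_right hbig (by linarith : 0 ≤ l)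
      have h5 : 29 * l * ((32 * (k : ℝ)) ^ 2 * 2) = 59392 * ((k : ℝ) ^ 2 * l) := by ring
      have h6 : 0 ≤ (k : ℝ) ^ 2 * l := by positivity
      rw [h5, sq l]
      linarith
    have h3 : 0 ≤ l / (32 * k) := by positivity
    linarith
  have h6Li : (6 * (1 + l)) ^ i ≤ Real.exp (l / 16) := by
    calc (6 * (1 + l)) ^ i ≤ (Real.exp (l / (32 * k))) ^ i := by gcongr
      _ = Real.exp (i * (l / (32 * k))) := by rw [← Real.exp_nat_mul]
      _ ≤ Real.exp ((2 * k) * (l / (32 * k))) := by gcongr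
      _ = Real.exp (l / 16) := by congr 1; field_simp; norm_num
  have h20 : 6 * Real.pi ≤ Real.exp (l / 16) := by
    have := Real.add_one_le_exp (l / 16)
    linarith
  have hB : (1 + l) ^ i / (N * (t / (2 * Real.pi) * (i.factorial / (3 * N) ^ (i + 1))) * H ^ i) ≤
      Real.exp (-(l / 8)) := by
    calc (1 + l) ^ i / (N * (t / (2 * Real.pi) * (i.factorial / (3 * N) ^ (i + 1))) * H ^ i)
        ≤ (1 + l) ^ i / (N * (t / (2 * Real.pi) * (1 / (3 * N) ^ (i + 1))) * (Real.exp (l / 2) / 2) ^ i) := by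
          gcongr
          linarith
      _ = 6 * Real.pi * (6 * (1 + l)) ^ i * (N ^ i / (t * Real.exp (l / 2) ^ i)) := by
          rw [mul_pow 6, div_pow, mul_pow 3, show (6 : ℝ) = 3 * 2 by norm_num, mul_pow 3 2]
          field_simp
          ring
      _ ≤ Real.exp (l / 16) * Real.exp (l / 16) * (N ^ i / (t * Real.exp (l / 2) ^ i)) := by gcongr
      _ = Real.exp (l / 16 + l / 16 + (i * l - (T + i * (l / 2)))) := by
          rw [hte, hNe, ← Real.exp_nat_mul, ← Real.exp_nat_mul, Real.exp_add, Real.exp_add, Real.exp_sub, Real.exp_add]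
      _ ≤ Real.exp (-(l / 8)) := by
          apply Real.exp_le_exp.mpr
          nlinarith
  have hA : 1 / (H : ℝ) ≤ 2 * Real.exp (-(l / 8)) := by
    calc 1 / (H : ℝ) ≤ 1 / (Real.exp (l / 2) / 2) := by
          gcongr; linarith
      _ = 2 * Real.exp (-(l / 2)) := by rw [Real.exp_neg]; field_simp
      _ ≤ _ := by gcongr; linarith
  set P := 2 ^ i with hP
  have hP1 : 1 ≤ P := Nat.one_le_two_pow
  have hPpos : (0 : ℝ) < P := by exact_mod_cast hP1
  have hfin : s ^ P ≤ (48 * Real.exp (-l / (8 * P))) ^ P := by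
    calc s ^ P ≤ 16 ^ P * (2 * Real.exp (-(l / 8)) + Real.exp (-(l / 8))) := by
          refine hmain.trans ?_; gcongr
      _ = 16 ^ P * 3 * Real.exp (-(l / 8)) := by ring
      _ ≤ 16 ^ P * 3 ^ P * Real.exp (-(l / 8)) := by
          gcongr
          calc (3 : ℝ) = 3 ^ 1 := by norm_num
            _ ≤ 3 ^ P := pow_le_pow_right₀ (by norm_num) hP1
      _ = _ := by
          rw [mul_pow, ← Real.exp_nat_mul, ← mul_pow]
          norm_num
          field_simp
  have hs' : s ≤ 48 * Real.exp (-l / (8 * P)) :=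
    le_of_pow_le_pow_left₀ (by omega) (by positivity) hfin
  have hP4 : (P : ℝ) ≤ 4 ^ k := by
    have : P ≤ 4 ^ k := by
      rw [hP, show 4 = 2 ^ 2 by norm_num, ← pow_mul]
      exact Nat.pow_le_pow_right (by norm_num) hikn
    exact_mod_cast this
  have hs2 : s ≤ 48 * Real.exp (-l / (8 * 4 ^ k)) := by
    refine hs'.trans ?_
    gcongr 48 * Real.exp ?_
    rw [neg_div, neg_div, neg_le_neg_iff]
    gcongr
  rw [hs, div_le_iff₀ hNpos] at hs2
  linarith

noncomputable def vterm (n : ℕ) (s : ℂ) : ℂ :=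
  (s - 1) * (n : ℂ) ^ (-s) + ((n + 1 : ℕ) : ℂ) ^ (1 - s) - (n : ℂ) ^ (1 - s)

lemma vterm_bound (n : ℕ) (hn : 1 ≤ n) (s : ℂ) (hs : 0 < s.re) :
    ‖vterm n s‖ ≤ ‖s - 1‖ * (‖s‖ * (n : ℝ) ^ (-s.re - 1)) := by
  have hn0 : (0 : ℝ) < n := by exact_mod_cast hn
  have hd1 : ∀ c : ℂ, ∀ x : ℝ, 0 < x → HasDerivAt (fun y : ℝ => (y : ℂ) ^ c) (c * (x : ℂ) ^ (c - 1)) x := by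
    intro c x hx
    have h1 : HasDerivAt (fun z : ℂ => z ^ c) (c * (x : ℂ) ^ (c - 1)) (x : ℂ) := by
      have := (hasDerivAt_id (x : ℂ)).cpow_const (c := c) (Or.inl (by simpa using hx))
      simpa using this
    exact h1.comp_ofReal
  have hB : ∀ x ∈ Set.Icc (n : ℝ) (n + 1), ‖(n : ℂ) ^ (-s) - (x : ℂ) ^ (-s)‖ ≤ ‖s‖ * (n : ℝ) ^ (-s.re - 1) := by
    intro x hx
    have hmv := norm_image_sub_le_of_norm_deriv_le_segment' (a := (n : ℝ)) (b := n + 1)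
      (f := fun y : ℝ => (y : ℂ) ^ (-s)) (f' := fun x : ℝ => -s * (x : ℂ) ^ (-s - 1))
      (C := ‖s‖ * (n : ℝ) ^ (-s.re - 1))
      (fun y hy => (hd1 (-s) y (by linarith [hy.1])).hasDerivWithinAt) ?_ x hx
    · rw [norm_sub_rev]
      simp only [Complex.ofReal_natCast] at hmv
      refine hmv.trans ?_
      have : x - n ≤ 1 := by linarith [hx.2]
      have h0 : 0 ≤ ‖s‖ * (n : ℝ) ^ (-s.re - 1) := by positivity
      nlinarith
    · intro y hy
      have hy0 : 0 < y := by linarith [hy.1]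
      rw [norm_mul, norm_neg, Complex.norm_cpow_eq_rpow_re_of_pos hy0]
      simp only [sub_re, neg_re, one_re]
      gcongr ‖s‖ * ?_
      exact Real.rpow_le_rpow_of_nonpos hn0 hy.1 (by linarith)
  have hmv := norm_image_sub_le_of_norm_deriv_le_segment' (a := (n : ℝ)) (b := n + 1)
      (f := fun y : ℝ => (s - 1) * (n : ℂ) ^ (-s) * ((y - n : ℝ) : ℂ) + (y : ℂ) ^ (1 - s))
      (f' := fun x : ℝ => (s - 1) * ((n : ℂ) ^ (-s) - (x : ℂ) ^ (-s)))
      (C := ‖s - 1‖ * (‖s‖ * (n : ℝ) ^ (-s.re - 1))) ?_ ?_ (n + 1) (by constructor <;> linarith)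
  · simp only [sub_self, ofReal_zero, mul_zero, zero_add, add_sub_cancel_left, mul_one, ofReal_one] at hmv
    have e : vterm n s = (s - 1) * (n : ℂ) ^ (-s) + (((n : ℝ) + 1 : ℝ) : ℂ) ^ (1 - s) - (((n : ℝ) : ℂ)) ^ (1 - s) := by
      unfold vterm
      push_cast
      ring
    rw [e]
    exact hmv
  · intro x hx
    apply HasDerivAt.hasDerivWithinAt
    have h1 := hd1 (1 - s) x (by linarith [hx.1])
    have h2 : HasDerivAt (fun y : ℝ => ((y - n : ℝ) : ℂ)) 1 x := by
      have := ((hasDerivAt_id x).sub_const (n : ℝ)).ofReal_comp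
      simpa using this
    have h3 := (h2.const_mul ((s - 1) * (n : ℂ) ^ (-s))).add h1
    refine h3.congr_deriv ?_
    have : 1 - s - 1 = -s := by ring
    rw [this]; ring
  · intro x hx
    rw [norm_mul]
    gcongr
    exact hB x ⟨hx.1, hx.2.le⟩

lemma vterm_diff (n : ℕ) (hn : 1 ≤ n) : Differentiable ℂ (vterm n) := by
  have hn0 : (n : ℂ) ≠ 0 := by exact_mod_cast (by omega : n ≠ 0)
  have hn1 : ((n + 1 : ℕ) : ℂ) ≠ 0 := by exact_mod_cast (by omega : n + 1 ≠ 0)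
  intro s
  unfold vterm
  refine DifferentiableAt.sub (DifferentiableAt.add (DifferentiableAt.mul (by fun_prop) ?_) ?_) ?_
  · exact DifferentiableAt.const_cpow (by fun_prop) (Or.inl hn0)
  · exact DifferentiableAt.const_cpow (by fun_prop) (Or.inl hn1)
  · exact DifferentiableAt.const_cpow (by fun_prop) (Or.inl hn0)

lemma vterm_sum (N : ℕ) (hN : 1 ≤ N) (s : ℂ) (hs : 1 < s.re) :
    HasSum (fun n => vterm (n + N) s)
      ((s - 1) * (riemannZeta s - ∑ n ∈ Finset.range N, (n : ℂ) ^ (-s)) - (N : ℂ) ^ (1 - s)) := by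
  have hsum : Summable (fun n => vterm (n + N) s) := by
    have h1 : Summable (fun n : ℕ => ‖s - 1‖ * (‖s‖ * (n : ℝ) ^ (-s.re - 1))) := by
      apply Summable.mul_left; apply Summable.mul_left
      exact Real.summable_nat_rpow.mpr (by linarith)
    have h2 := (summable_nat_add_iff N).mpr h1
    refine Summable.of_norm_bounded h2 ?_
    intro n
    exact vterm_bound (n + N) (by omega) s (by linarith)
  have hz : HasSum (fun n : ℕ => (n : ℂ) ^ (-s)) (riemannZeta s) := by
    have h1 := zeta_eq_tsum_one_div_nat_cpow hs
    rw [h1]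
    have h2 : Summable (fun n : ℕ => 1 / (n : ℂ) ^ s) := Complex.summable_one_div_nat_cpow.mpr hs
    convert h2.hasSum using 2 with n
    rw [Complex.cpow_neg, one_div]
  have hz2 := (hasSum_nat_add_iff' N).mpr hz
  rw [hsum.hasSum_iff_tendsto_nat]
  have htel : ∀ K, ∑ n ∈ Finset.range K, vterm (n + N) s =
      (s - 1) * ∑ n ∈ Finset.range K, ((n + N : ℕ) : ℂ) ^ (-s) + ((K + N : ℕ) : ℂ) ^ (1 - s) - (N : ℂ) ^ (1 - s) := by
    intro K
    induction K with
    | zero => simp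
    | succ K ih =>
      rw [Finset.sum_range_succ, ih, Finset.sum_range_succ, vterm]
      have : K + N + 1 = K + 1 + N := by ring
      rw [this]; ring
  simp_rw [htel]
  have hlim : Tendsto (fun K : ℕ => ((K + N : ℕ) : ℂ) ^ (1 - s)) atTop (𝓝 0) := by
    rw [tendsto_zero_iff_norm_tendsto_zero]
    have h1 : ∀ K : ℕ, ‖((K + N : ℕ) : ℂ) ^ (1 - s)‖ = ((K + N : ℕ) : ℝ) ^ (-(s.re - 1)) := by
      intro K
      rw [Complex.norm_natCast_cpow_of_pos (by omega)]
      simp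
    simp_rw [h1]
    have h2 := (tendsto_rpow_neg_atTop (y := s.re - 1) (by linarith)).comp tendsto_natCast_atTop_atTop
    exact (tendsto_add_atTop_iff_nat N).mpr h2
  have := ((hz2.tendsto_sum_nat.const_mul (s - 1)).add hlim).sub_const ((N : ℂ) ^ (1 - s))
  simpa using this

lemma zeta_identity (N : ℕ) (hN : 1 ≤ N) (s : ℂ) (hs : 0 < s.re) (hs1 : s ≠ 1) :
    ∑' n, vterm (n + N) s =
      (s - 1) * (riemannZeta s - ∑ n ∈ Finset.range N, (n : ℂ) ^ (-s)) - (N : ℂ) ^ (1 - s) := by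
  set δ := min (s.re / 2) 1 with hδ
  have hδ0 : 0 < δ := by rw [hδ]; positivity
  set R := ‖s‖ + 3 with hR
  set U : Set ℂ := {z | δ < z.re} ∩ Metric.ball 0 R with hU
  have hUo : IsOpen U := (isOpen_lt continuous_const Complex.continuous_re).inter Metric.isOpen_ball
  have hUc : IsPreconnected U := ((convex_halfSpace_re_gt δ).inter (convex_ball 0 R)).isPreconnected
  have hd1 : DifferentiableOn ℂ (fun z => ∑' n, vterm (n + N) z) U := by
    apply differentiableOn_tsum_of_summable_norm
      (u := fun n : ℕ => (R + 1) * (R * ((n + N : ℕ) : ℝ) ^ (-δ - 1)))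
    · apply Summable.mul_left; apply Summable.mul_left
      have h1 : Summable (fun n : ℕ => (n : ℝ) ^ (-δ - 1)) := Real.summable_nat_rpow.mpr (by linarith)
      exact (summable_nat_add_iff N).mpr h1
    · intro n; exact (vterm_diff (n + N) (by omega)).differentiableOn
    · exact hUo
    · intro n z hz
      have hz1 : δ < z.re := hz.1
      have hz2 : ‖z‖ < R := by simpa using hz.2
      refine (vterm_bound (n + N) (by omega) z (by linarith)).trans ?_
      have : ‖z - 1‖ ≤ R + 1 := by
        refine (norm_sub_le _ _).trans ?_
        simp; linarith
      have h1 : (1 : ℝ) ≤ ((n + N : ℕ) : ℝ) := by exact_mod_cast (by omega : 1 ≤ n + N)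
      gcongr
  set F2 : ℂ → ℂ := fun z => riemannZeta₁ z - (z - 1) * ∑ n ∈ Finset.Ico 1 N, (n : ℂ) ^ (-z) - (N : ℂ) ^ (1 - z) with hF2
  have hNc : (N : ℂ) ≠ 0 := by exact_mod_cast (by omega : N ≠ 0)
  have hd2 : Differentiable ℂ F2 := by
    intro z
    refine DifferentiableAt.sub (DifferentiableAt.sub (differentiable_riemannZeta₁ z)
      (DifferentiableAt.mul (by fun_prop) ?_)) ?_
    · apply DifferentiableAt.fun_sum
      intro n hn
      have : (n : ℂ) ≠ 0 := by
        have := (Finset.mem_Ico.mp hn).1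
        exact_mod_cast (by omega : n ≠ 0)
      exact DifferentiableAt.const_cpow (by fun_prop) (Or.inl this)
    · exact DifferentiableAt.const_cpow (by fun_prop) (Or.inl hNc)
  have hF2eq : ∀ z : ℂ, z ≠ 1 → 0 < z.re → F2 z = (z - 1) * (riemannZeta z - ∑ n ∈ Finset.range N, (n : ℂ) ^ (-z)) - (N : ℂ) ^ (1 - z) := by
    intro z hz hzre
    have h1 := riemannZeta_eq_inv_sub_mul hz
    have h2 : z - 1 ≠ 0 := sub_ne_zero.mpr hz
    have h3 : riemannZeta₁ z = (z - 1) * riemannZeta z := by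
      rw [h1]; field_simp
    have h4 : ∑ n ∈ Finset.range N, (n : ℂ) ^ (-z) = ∑ n ∈ Finset.Ico 1 N, (n : ℂ) ^ (-z) := by
      rw [Finset.range_eq_Ico, Finset.sum_eq_sum_Ico_succ_bot (by omega)]
      have : -z ≠ 0 := by
        intro h; have := congrArg Complex.re h; simp at this; linarith
      simp [Complex.zero_cpow this]
    simp only [hF2]
    rw [h3, h4]; ring
  have heq : Set.EqOn (fun z => ∑' n, vterm (n + N) z) F2 U := by
    apply (hd1.analyticOnNhd hUo).eqOn_of_preconnected_of_eventuallyEq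
      (hd2.differentiableOn.analyticOnNhd hUo) hUc (z₀ := 2)
    · constructor
      · change δ < (2 : ℂ).re
        have : δ ≤ 1 := min_le_right _ _
        simp; linarith
      · simp [hR]; linarith [norm_nonneg s]
    · have : ∀ᶠ z : ℂ in 𝓝 2, 1 < z.re :=
        (isOpen_lt continuous_const Complex.continuous_re).mem_nhds (by simp)
      filter_upwards [this] with z hz
      rw [(vterm_sum N hN z hz).tsum_eq, hF2eq z (by rintro rfl; simp at hz) (by linarith)]
  have hsU : s ∈ U := by
    constructor
    · have : δ ≤ s.re / 2 := min_le_left _ _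
      change δ < s.re; linarith
    · simp [hR]
  have := heq hsU
  simp only at this
  rw [this, hF2eq s hs1 hs]

lemma zeta_approx : ∃ C0 : ℝ, 0 < C0 ∧ ∀ (N : ℕ) (s : ℂ), 1 ≤ N → 3 / 4 ≤ s.re → s ≠ 1 →
    ‖riemannZeta s - ∑ n ∈ Finset.range N, (n : ℂ) ^ (-s) - (N : ℂ) ^ (1 - s) / (s - 1)‖ ≤
      C0 * ‖s‖ * (N : ℝ) ^ (-(1 / 2) : ℝ) := by
  have hsm : Summable (fun n : ℕ => (n : ℝ) ^ (-(5 / 4) : ℝ)) := Real.summable_nat_rpow.mpr (by norm_num)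
  refine ⟨∑' n : ℕ, (n : ℝ) ^ (-(5 / 4) : ℝ) + 1, by positivity, ?_⟩
  intro N s hN hs hs1
  have hs2 : s - 1 ≠ 0 := sub_ne_zero.mpr hs1
  have hid := zeta_identity N hN s (by linarith) hs1
  have e : riemannZeta s - ∑ n ∈ Finset.range N, (n : ℂ) ^ (-s) - (N : ℂ) ^ (1 - s) / (s - 1) =
      (∑' n, vterm (n + N) s) / (s - 1) := by
    rw [hid]; field_simp
  rw [e, norm_div, div_le_iff₀ (norm_pos_iff.mpr hs2)]
  have hN0 : (0 : ℝ) < N := by exact_mod_cast hN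
  set K := ‖s - 1‖ * ‖s‖ * (N : ℝ) ^ (-(1 / 2) : ℝ) with hK
  have hK0 : 0 ≤ K := by positivity
  have hsm2 := ((summable_nat_add_iff N).mpr hsm).mul_left K
  have hb : ∀ n : ℕ, ‖vterm (n + N) s‖ ≤ K * ((n + N : ℕ) : ℝ) ^ (-(5 / 4) : ℝ) := by
    intro n
    refine (vterm_bound (n + N) (by omega) s (by linarith)).trans ?_
    rw [hK, mul_assoc, mul_assoc]
    gcongr
    have h1 : (1 : ℝ) ≤ ((n + N : ℕ) : ℝ) := by exact_mod_cast (by omega : 1 ≤ n + N)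
    have h2 : (N : ℝ) ≤ ((n + N : ℕ) : ℝ) := by exact_mod_cast (by omega : N ≤ n + N)
    calc ((n + N : ℕ) : ℝ) ^ (-s.re - 1) ≤ ((n + N : ℕ) : ℝ) ^ (-(1 / 2) + -(5 / 4) : ℝ) := by
          apply Real.rpow_le_rpow_of_exponent_le h1; linarith
      _ = ((n + N : ℕ) : ℝ) ^ (-(1 / 2) : ℝ) * ((n + N : ℕ) : ℝ) ^ (-(5 / 4) : ℝ) :=
          Real.rpow_add (by linarith) _ _
      _ ≤ _ := by
          gcongr ?_ * _
          exact Real.rpow_le_rpow_of_nonpos hN0 h2 (by norm_num)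
  refine (tsum_of_norm_bounded hsm2.hasSum hb).trans ?_
  rw [tsum_mul_left]
  have hle : ∑' n : ℕ, ((n + N : ℕ) : ℝ) ^ (-(5 / 4) : ℝ) ≤ ∑' n : ℕ, (n : ℝ) ^ (-(5 / 4) : ℝ) := by
    rw [← hsm.sum_add_tsum_nat_add N]
    have : 0 ≤ ∑ i ∈ Finset.range N, (i : ℝ) ^ (-(5 / 4) : ℝ) := by positivity
    linarith
  calc K * ∑' n : ℕ, ((n + N : ℕ) : ℝ) ^ (-(5 / 4) : ℝ) ≤ K * (∑' n : ℕ, (n : ℝ) ^ (-(5 / 4) : ℝ) + 1) := by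
        gcongr; linarith
    _ = _ := by rw [hK]; ring

lemma abel_bound (N : ℕ) (w : ℕ → ℝ) (z : ℕ → ℂ) (B : ℝ) (hw : Antitone w) (hw0 : ∀ n, 0 ≤ w n)
    (hB : ∀ M ≤ N, ‖∑ n ∈ Finset.range M, z n‖ ≤ B) :
    ‖∑ n ∈ Finset.range N, (w n : ℂ) * z n‖ ≤ w 0 * B := by
  have hB0 : 0 ≤ B := by simpa using hB 0 (Nat.zero_le _)
  have key : ∀ m, m + 1 ≤ N → ‖∑ n ∈ Finset.range (m + 1), (w n : ℂ) * z n -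
      (w m : ℂ) * ∑ n ∈ Finset.range (m + 1), z n‖ ≤ (w 0 - w m) * B := by
    intro m
    induction m with
    | zero => intro _; simp
    | succ m ih =>
      intro hm
      have h1 := ih (by omega)
      have e : ∑ n ∈ Finset.range (m + 1 + 1), (w n : ℂ) * z n -
          (w (m + 1) : ℂ) * ∑ n ∈ Finset.range (m + 1 + 1), z n =
          (∑ n ∈ Finset.range (m + 1), (w n : ℂ) * z n -
          (w m : ℂ) * ∑ n ∈ Finset.range (m + 1), z n) +
          ((w m - w (m + 1) : ℝ) : ℂ) * ∑ n ∈ Finset.range (m + 1), z n := by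
        rw [Finset.sum_range_succ _ (m + 1), Finset.sum_range_succ _ (m + 1)]
        push_cast
        ring
      rw [e]
      refine (norm_add_le _ _).trans ?_
      rw [norm_mul, Complex.norm_real, Real.norm_of_nonneg (by linarith [hw (Nat.le_succ m)])]
      have h2 := hB (m + 1) (by omega)
      have h3 : 0 ≤ w m - w (m + 1) := by linarith [hw (Nat.le_succ m)]
      nlinarith
  rcases N with _ | m
  · simp; exact mul_nonneg (hw0 0) hB0
  · have h1 := key m le_rfl
    have h2 := hB (m + 1) le_rfl
    have h3 := norm_sub_norm_le (∑ n ∈ Finset.range (m + 1), (w n : ℂ) * z n)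
      ((w m : ℂ) * ∑ n ∈ Finset.range (m + 1), z n)
    rw [norm_mul, Complex.norm_real, Real.norm_of_nonneg (hw0 m)] at h3
    nlinarith [hw0 m]

lemma cpow_split (x σ t : ℝ) (hx : 0 < x) :
    (x : ℂ) ^ (-(σ + t * I) : ℂ) = ((x ^ (-σ) : ℝ) : ℂ) *
      (starRingEnd ℂ) (ee (t / (2 * Real.pi) * Real.log x)) := by
  have hx0 : (x : ℂ) ≠ 0 := by exact_mod_cast hx.ne'
  rw [neg_add, Complex.cpow_add _ _ hx0, Complex.ofReal_cpow hx.le]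
  push_cast
  congr 1
  rw [ee, ← Complex.exp_conj, Complex.cpow_def_of_ne_zero hx0]
  congr 1
  have hpi : (Real.pi : ℂ) ≠ 0 := by exact_mod_cast Real.pi_ne_zero
  rw [← Complex.ofReal_log hx.le]
  simp only [map_mul, Complex.conj_ofReal, Complex.conj_I, map_ofNat]
  push_cast
  field_simp

lemma zeta_block (k N : ℕ) (t σ : ℝ) (hk : 1 ≤ k) (ht : 1 ≤ t) (hN : 1 ≤ N)
    (hbig : 60000 * (k : ℝ) ^ 3 ≤ Real.log t) (hN2 : Real.log N ≤ 2 * Real.log t)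
    (hσ : 1 - 1 / (8 * 4 ^ k) ≤ σ) :
    ‖∑ n ∈ Finset.range N, ((N + n : ℕ) : ℂ) ^ (-(σ + t * I) : ℂ)‖ ≤
      48 * Real.exp (Real.log t / (8 * 4 ^ k * k)) := by
  have hNpos : (0 : ℝ) < N := by exact_mod_cast hN
  have hlogN : 0 ≤ Real.log N := Real.log_nonneg (by exact_mod_cast hN)
  have hlt : 0 ≤ Real.log t := Real.log_nonneg ht
  have hkpos : (0 : ℝ) < k := by exact_mod_cast hk
  have h4 : (4 : ℝ) ≤ 4 ^ k := by
    calc (4 : ℝ) = 4 ^ 1 := by norm_num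
      _ ≤ 4 ^ k := pow_le_pow_right₀ (by norm_num) hk
  set θ : ℝ := 1 / (8 * 4 ^ k) with hθ
  have hθ0 : 0 < θ := by positivity
  have hθ1 : θ ≤ 1 / 32 := by
    rw [hθ]; apply one_div_le_one_div_of_le <;> linarith
  have hσ0 : 0 < σ := by linarith
  have hE : Real.log t / (8 * 4 ^ k * k) = θ * (Real.log t / k) := by
    rw [hθ]; field_simp
  rw [hE]
  have hab : ∀ B : ℝ, (∀ M ≤ N, ‖∑ n ∈ Finset.range M, ee (t / (2 * Real.pi) * Real.log (N + n))‖ ≤ B) →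
      ‖∑ n ∈ Finset.range N, ((N + n : ℕ) : ℂ) ^ (-(σ + t * I) : ℂ)‖ ≤ (N : ℝ) ^ (-σ) * B := by
    intro B hB
    have := abel_bound N (fun n => ((N : ℝ) + n) ^ (-σ))
      (fun n => (starRingEnd ℂ) (ee (t / (2 * Real.pi) * Real.log (N + n)))) B ?_ ?_ ?_
    · simp only [Nat.cast_zero, add_zero] at this
      refine le_trans (le_of_eq ?_) this
      congr 1
      apply Finset.sum_congr rfl
      intro n _
      rw [← cpow_split _ _ _ (by positivity)]
      push_cast
      rfl
    · intro a b hab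
      apply Real.rpow_le_rpow_of_nonpos (by positivity) _ (by linarith)
      have : (a : ℝ) ≤ b := by exact_mod_cast hab
      linarith
    · intro n; positivity
    · intro M hM
      rw [← map_sum, RCLike.norm_conj]
      exact hB M hM
  by_cases hc : Real.log t ≤ k * Real.log N
  · have h1 := hab (48 * N * Real.exp (-(Real.log N) / (8 * 4 ^ k))) (fun M hM =>
      block k N M t hk (by linarith) hM hc hN2 (by
        have : 60000 * (k : ℝ) ^ 2 * k ≤ k * Real.log N := by
          calc _ = 60000 * (k : ℝ) ^ 3 := by ring
            _ ≤ _ := hbig.trans hc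
        nlinarith))
    refine h1.trans ?_
    have h2 : (N : ℝ) ^ (-σ) * (48 * N * Real.exp (-(Real.log N) / (8 * 4 ^ k))) =
        48 * Real.exp ((1 - σ - θ) * Real.log N) := by
      rw [Real.rpow_def_of_pos hNpos]
      have : (N : ℝ) = Real.exp (Real.log N) := (Real.exp_log hNpos).symm
      nth_rewrite 2 [this]
      have e : (1 - σ - θ) * Real.log N = Real.log N * -σ + (Real.log N + -(Real.log N) / (8 * 4 ^ k)) := by
        rw [hθ]; ring
      rw [e, Real.exp_add, Real.exp_add]; ring
    rw [h2]
    have : (1 - σ - θ) * Real.log N ≤ θ * (Real.log t / k) := by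
      have : (1 - σ - θ) * Real.log N ≤ 0 := mul_nonpos_of_nonpos_of_nonneg (by linarith) hlogN
      have : 0 ≤ θ * (Real.log t / k) := by positivity
      linarith
    gcongr
  · have h1 := hab N (fun M hM => by
      refine (norm_sum_le _ _).trans ?_
      have : ∀ x : ℝ, ‖ee x‖ = 1 := by
        intro x; rw [ee]
        have : (2 * Real.pi * x * I : ℂ) = ((2 * Real.pi * x : ℝ) : ℂ) * I := by push_cast; ring
        rw [this, Complex.norm_exp_ofReal_mul_I]
      simp only [this]
      simpa using hM)
    refine h1.trans ?_
    have h2 : (N : ℝ) ^ (-σ) * N = Real.exp ((1 - σ) * Real.log N) := by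
      rw [Real.rpow_def_of_pos hNpos]
      have : (N : ℝ) = Real.exp (Real.log N) := (Real.exp_log hNpos).symm
      nth_rewrite 2 [this]
      rw [← Real.exp_add]; congr 1; ring
    rw [h2]
    have h3 : Real.log N ≤ Real.log t / k := by
      rw [le_div_iff₀ hkpos]; linarith
    have h4 : (1 - σ) * Real.log N ≤ θ * (Real.log t / k) := by
      calc (1 - σ) * Real.log N ≤ θ * Real.log N := by
            apply mul_le_mul_of_nonneg_right _ hlogN; linarith
        _ ≤ _ := by gcongr
    have := Real.exp_le_exp.mpr h4
    have := Real.exp_pos (θ * (Real.log t / k))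
    linarith

lemma zeta_bound_pos : ∃ C : ℝ, 0 < C ∧ ∀ (k : ℕ) (t σ : ℝ), 1 ≤ k → 1 ≤ t →
    60000 * (k : ℝ) ^ 3 ≤ Real.log t → 1 - 1 / (8 * 4 ^ k) ≤ σ → σ ≤ 3 →
    ‖riemannZeta (σ + t * I)‖ ≤ C * Real.log t * Real.exp (Real.log t / (8 * 4 ^ k * k)) := by
  obtain ⟨C0, hC0, happ⟩ := zeta_approx
  refine ⟨193 + 4 * C0, by positivity, ?_⟩
  intro k t σ hk ht hbig hσ hσ3
  have hkr : (1 : ℝ) ≤ k := by exact_mod_cast hk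
  have hL : 60000 ≤ Real.log t := by
    have : (1 : ℝ) ≤ (k : ℝ) ^ 3 := one_le_pow₀ hkr
    linarith
  have ht0 : 0 < t := by linarith
  have ht3 : 60000 ≤ t := by linarith [Real.log_le_sub_one_of_pos ht0]
  have h4 : (4 : ℝ) ≤ 4 ^ k := by
    calc (4 : ℝ) = 4 ^ 1 := by norm_num
      _ ≤ 4 ^ k := pow_le_pow_right₀ (by norm_num) hk
  have hθ1 : (1 : ℝ) / (8 * 4 ^ k) ≤ 1 / 32 := by
    apply one_div_le_one_div_of_le <;> linarith
  have hσ0 : 31 / 32 ≤ σ := by linarith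
  set E := Real.exp (Real.log t / (8 * 4 ^ k * k)) with hE
  have hE1 : 1 ≤ E := by
    rw [hE]; apply Real.one_le_exp; positivity
  obtain ⟨J, hJ1, hJ2⟩ : ∃ J : ℕ, t ^ 2 < 2 ^ (J + 1) ∧ (2 : ℝ) ^ J ≤ t ^ 2 := by
    obtain ⟨n, h1, h2⟩ := exists_nat_pow_near (x := t ^ 2) (y := 2) (by nlinarith) (by norm_num)
    exact ⟨n, h2, h1⟩
  have hs_re : ((σ : ℂ) + t * I).re = σ := by simp
  have hs_im : ((σ : ℂ) + t * I).im = t := by simp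
  set s : ℂ := σ + t * I with hs
  have hs0 : s ≠ 0 := by
    intro h; rw [h] at hs_re; simp at hs_re; linarith
  have hs1 : s ≠ 1 := by
    intro h; rw [h] at hs_im; simp at hs_im; linarith
  have hlog2 : (1 : ℝ) / 2 ≤ Real.log 2 := by linarith [Real.log_two_gt_d9]
  have hJlog : J * Real.log 2 ≤ 2 * Real.log t := by
    have := Real.log_le_log (by positivity) hJ2
    rwa [Real.log_pow, Real.log_pow] at this
  have hsum : ∀ j, j ≤ J + 1 → ‖∑ n ∈ Finset.range (2 ^ j), (n : ℂ) ^ (-s)‖ ≤ j * (48 * E) := by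
    intro j
    induction j with
    | zero => intro _; simp [Complex.zero_cpow (neg_ne_zero.mpr hs0)]
    | succ j ih =>
      intro hj
      have e : 2 ^ (j + 1) = 2 ^ j + 2 ^ j := by ring
      rw [e, Finset.sum_range_add]
      refine (norm_add_le _ _).trans ?_
      have h1 := ih (by omega)
      have h2 := zeta_block k (2 ^ j) t σ hk ht Nat.one_le_two_pow hbig (by
        push_cast
        rw [Real.log_pow]
        refine le_trans ?_ hJlog
        have : (j : ℝ) ≤ J := by exact_mod_cast (by omega : j ≤ J)
        have : 0 ≤ Real.log 2 := by linarith
        gcongr) hσ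
      rw [← hs, ← hE] at h2
      push_cast at h1 h2 ⊢
      linarith
  have h1 := hsum (J + 1) le_rfl
  have h2 := happ (2 ^ (J + 1)) s Nat.one_le_two_pow (by rw [hs_re]; linarith) hs1
  have hNt : t ^ 2 ≤ ((2 ^ (J + 1) : ℕ) : ℝ) := by push_cast; exact hJ1.le
  have hNt2 : ((2 ^ (J + 1) : ℕ) : ℝ) ≤ 2 * t ^ 2 := by
    push_cast; rw [pow_succ]; linarith
  set N : ℕ := 2 ^ (J + 1) with hN
  have hN1 : (1 : ℝ) ≤ N := by nlinarith
  have h3 : ‖(N : ℂ) ^ (1 - s) / (s - 1)‖ ≤ 1 := by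
    rw [norm_div]
    have a1 : ‖(N : ℂ) ^ (1 - s)‖ ≤ t := by
      have := Complex.norm_cpow_eq_rpow_re_of_pos (x := (N : ℝ)) (by linarith) (1 - s)
      rw [Complex.ofReal_natCast] at this
      rw [this, sub_re, one_re, hs_re]
      calc (N : ℝ) ^ (1 - σ) ≤ (N : ℝ) ^ (1 / 3 : ℝ) := by
            apply Real.rpow_le_rpow_of_exponent_le hN1; linarith
        _ ≤ (t ^ 3) ^ (1 / 3 : ℝ) := by
            apply Real.rpow_le_rpow (by linarith) _ (by norm_num)
            nlinarith [sq_nonneg t]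
        _ = t := by
            rw [← Real.rpow_natCast, ← Real.rpow_mul ht0.le]; norm_num
    have a2 : t ≤ ‖s - 1‖ := by
      have := Complex.abs_im_le_norm (s - 1)
      rw [sub_im, hs_im, one_im, sub_zero] at this
      linarith [le_abs_self t]
    exact div_le_one_of_le₀ (a1.trans a2) (norm_nonneg _)
  have h4 : C0 * ‖s‖ * (N : ℝ) ^ (-(1 / 2) : ℝ) ≤ 4 * C0 := by
    have a1 : ‖s‖ ≤ 4 * t := by
      have : ‖s‖ ≤ |s.re| + |s.im| := Complex.norm_le_abs_re_add_abs_im s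
      rw [hs_re, hs_im, abs_of_pos ht0, abs_of_pos (by linarith)] at this
      linarith
    have a2 : (N : ℝ) ^ (-(1 / 2) : ℝ) ≤ t⁻¹ := by
      calc (N : ℝ) ^ (-(1 / 2) : ℝ) ≤ (t ^ 2) ^ (-(1 / 2) : ℝ) :=
            Real.rpow_le_rpow_of_nonpos (by positivity) hNt (by norm_num)
        _ = t⁻¹ := by
            rw [← Real.rpow_natCast, ← Real.rpow_mul ht0.le]; norm_num
            rw [Real.rpow_neg_one]
    calc C0 * ‖s‖ * (N : ℝ) ^ (-(1 / 2) : ℝ) ≤ C0 * (4 * t) * t⁻¹ := by gcongr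
      _ = 4 * C0 := by field_simp
  have hJle : ((J + 1 : ℕ) : ℝ) ≤ 4 * Real.log t + 1 := by
    push_cast
    have : (J : ℝ) * (1 / 2) ≤ J * Real.log 2 := by gcongr
    linarith
  have h5 : ‖riemannZeta s‖ ≤ ((J + 1 : ℕ) : ℝ) * (48 * E) + 1 + 4 * C0 := by
    have : riemannZeta s = (riemannZeta s - ∑ n ∈ Finset.range N, (n : ℂ) ^ (-s) - (N : ℂ) ^ (1 - s) / (s - 1)) +
      ∑ n ∈ Finset.range N, (n : ℂ) ^ (-s) + (N : ℂ) ^ (1 - s) / (s - 1) := by ring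
    rw [this]
    refine (norm_add₃_le).trans ?_
    linarith
  refine h5.trans ?_
  have b1 : ((J + 1 : ℕ) : ℝ) * (48 * E) ≤ (4 * Real.log t + 1) * (48 * E) := by gcongr
  have b2 : 60000 * E ≤ Real.log t * E := by gcongr
  have b3 : C0 * 1 ≤ C0 * (Real.log t * E) := by
    gcongr; nlinarith
  nlinarith

lemma logDeriv_bound_nonvanishing (h : ℂ → ℂ) (d M : ℝ) (hd : 0 < d) (hM : 0 < M)
    (hdiff : DifferentiableOn ℂ h (Metric.ball 0 (2 * d))) (hne : ∀ z ∈ Metric.ball (0 : ℂ) (2 * d), h z ≠ 0)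
    (hb : ∀ z ∈ Metric.ball (0 : ℂ) (2 * d), ‖h z‖ ≤ Real.exp M * ‖h 0‖) (s : ℂ) (hs : ‖s‖ ≤ d) :
    ‖deriv h s / h s‖ ≤ 12 * M / d := by
  have hopen : IsOpen (Metric.ball (0 : ℂ) (2 * d)) := Metric.isOpen_ball
  have h0mem : (0 : ℂ) ∈ Metric.ball (0 : ℂ) (2 * d) := by simp [hd]
  have h1 : DifferentiableOn ℂ (fun z => deriv h z / h z) (Metric.ball 0 (2 * d)) :=
    (hdiff.deriv hopen).div hdiff hne
  obtain ⟨g, hg0, hg⟩ := h1.isExactOn_ball.with_val_at 0 0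
  have hgd : DifferentiableOn ℂ g (Metric.ball 0 (2 * d)) :=
    fun z hz => (hg z hz).differentiableAt.differentiableWithinAt
  have hhd : ∀ z ∈ Metric.ball (0 : ℂ) (2 * d), HasDerivAt h (deriv h z) z := fun z hz =>
    (hdiff.differentiableAt (hopen.mem_nhds hz)).hasDerivAt
  have hφ : ∀ z ∈ Metric.ball (0 : ℂ) (2 * d), HasDerivAt (fun z => h z * cexp (-g z)) 0 z := by
    intro z hz
    have := (hhd z hz).mul ((hg z hz).neg.cexp)
    refine this.congr_deriv ?_
    have := hne z hz
    field_simp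
    simp
  have hconst : ∀ z ∈ Metric.ball (0 : ℂ) (2 * d), h z * cexp (-g z) = h 0 := by
    intro z hz
    have := (convex_ball (0 : ℂ) (2 * d)).norm_image_sub_le_of_norm_hasDerivWithin_le (𝕜 := ℂ)
      (f := fun z => h z * cexp (-g z)) (f' := fun _ => 0) (C := 0)
      (fun x hx => (hφ x hx).hasDerivWithinAt) (by simp) h0mem hz
    simp only [zero_mul, norm_le_zero_iff, sub_eq_zero] at this
    rw [this, hg0]; simp
  have hre : Set.MapsTo g (Metric.ball 0 (2 * d)) {z | z.re ≤ M} := by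
    intro z hz
    have e1 := hconst z hz
    have e2 : ‖h z‖ = ‖h 0‖ * Real.exp (g z).re := by
      rw [← e1, norm_mul, Complex.norm_exp, mul_assoc, ← Real.exp_add]; simp
    have e3 := hb z hz
    have e4 : 0 < ‖h 0‖ := norm_pos_iff.mpr (hne 0 h0mem)
    rw [e2, mul_comm] at e3
    have := le_of_mul_le_mul_right e3 e4
    exact Real.exp_le_exp.mp this
  have hsub : Metric.closedBall s (d / 2) ⊆ Metric.ball 0 (2 * d) := by
    intro z hz
    rw [mem_closedBall_iff_norm] at hz
    rw [mem_ball_zero_iff]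
    have : ‖z‖ ≤ ‖z - s‖ + ‖s‖ := by simpa using norm_add_le (z - s) s
    linarith
  have hfin := norm_deriv_le_of_forall_mem_sphere_norm_le (c := s) (R := d / 2) (C := 6 * M) (f := g)
    (by positivity) ?_ ?_
  · have hsmem : s ∈ Metric.ball (0 : ℂ) (2 * d) := hsub (by simp; positivity)
    rw [(hg s hsmem).deriv] at hfin
    refine hfin.trans (le_of_eq ?_)
    field_simp; norm_num
  · apply DifferentiableOn.diffContOnCl
    rw [closure_ball _ (by positivity)]
    exact hgd.mono hsub
  · intro z hz
    have hzm := hsub (Metric.sphere_subset_closedBall hz)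
    have hbc := borelCaratheodory_zero hM hgd hre (by positivity) hzm hg0
    refine hbc.trans ?_
    rw [mem_sphere_iff_norm] at hz
    have hz2 : ‖z‖ ≤ 3 / 2 * d := by
      have : ‖z‖ ≤ ‖z - s‖ + ‖s‖ := by simpa using norm_add_le (z - s) s
      linarith
    rw [div_le_iff₀ (by linarith)]
    nlinarith

/-- `zfac f d n` : the function has a factorization with `n` zeros. -/
def zfac (f : ℂ → ℂ) (d : ℝ) (n : ℕ) : Prop :=
  ∃ (ρ : Fin n → ℂ) (g : ℂ → ℂ), (∀ i, ‖ρ i‖ ≤ 2 * d ∧ ρ i ≠ 0 ∧ f (ρ i) = 0) ∧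
    DifferentiableOn ℂ g (Metric.ball 0 (12 * d)) ∧
    ∀ z ∈ Metric.ball (0 : ℂ) (12 * d), f z = g z * ∏ i, (1 - z / ρ i)

lemma zfac_succ (f : ℂ → ℂ) (d : ℝ) (hd : 0 < d) (hf0 : f 0 ≠ 0) (n : ℕ) (ρ : Fin n → ℂ) (g : ℂ → ℂ)
    (hρ : ∀ i, ‖ρ i‖ ≤ 2 * d ∧ ρ i ≠ 0 ∧ f (ρ i) = 0)
    (hg : DifferentiableOn ℂ g (Metric.ball 0 (12 * d)))
    (hfg : ∀ z ∈ Metric.ball (0 : ℂ) (12 * d), f z = g z * ∏ i, (1 - z / ρ i))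
    (w : ℂ) (hw : ‖w‖ ≤ 2 * d) (hgw : g w = 0) : zfac f d (n + 1) := by
  have hwm : w ∈ Metric.ball (0 : ℂ) (12 * d) := by rw [mem_ball_zero_iff]; linarith
  have hfw : f w = 0 := by rw [hfg w hwm, hgw, zero_mul]
  have hw0 : w ≠ 0 := by rintro rfl; exact hf0 hfw
  refine ⟨Fin.cons w ρ, fun z => -w * dslope g w z, ?_, ?_, ?_⟩
  · intro i
    refine Fin.cases ?_ ?_ i
    · exact ⟨hw, hw0, hfw⟩
    · intro i; simpa using hρ i
  · exact ((Complex.differentiableOn_dslope (Metric.isOpen_ball.mem_nhds hwm)).mpr hg).const_mul _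
  · intro z hz
    rw [hfg z hz, Fin.prod_univ_succ]
    simp only [Fin.cons_zero, Fin.cons_succ]
    have := sub_smul_dslope g w z
    rw [hgw, sub_zero, smul_eq_mul] at this
    rw [← this]
    field_simp
    ring

lemma zfac_max (f : ℂ → ℂ) (d : ℝ) (hd : 0 < d) (n : ℕ) (ρ : Fin n → ℂ) (g : ℂ → ℂ) (M : ℝ)
    (hb : ∀ z ∈ Metric.ball (0 : ℂ) (12 * d), ‖f z‖ ≤ Real.exp M * ‖f 0‖)
    (hρ : ∀ i, ‖ρ i‖ ≤ 2 * d ∧ ρ i ≠ 0 ∧ f (ρ i) = 0)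
    (hg : DifferentiableOn ℂ g (Metric.ball 0 (12 * d)))
    (hfg : ∀ z ∈ Metric.ball (0 : ℂ) (12 * d), f z = g z * ∏ i, (1 - z / ρ i)) :
    g 0 = f 0 ∧ ∀ z ∈ Metric.closedBall (0 : ℂ) (6 * d), ‖g z‖ * 2 ^ n ≤ Real.exp M * ‖f 0‖ := by
  constructor
  · have := hfg 0 (by simp [hd])
    rw [this]; simp
  · intro z hz
    rw [← le_div_iff₀ (by positivity)]
    apply Complex.norm_le_of_forall_mem_frontier_norm_le (U := Metric.ball (0 : ℂ) (6 * d)) Metric.isBounded_ball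
    · apply DifferentiableOn.diffContOnCl
      rw [closure_ball _ (by positivity)]
      exact hg.mono (Metric.closedBall_subset_ball (by linarith))
    · intro y hy
      rw [frontier_ball _ (by positivity), mem_sphere_zero_iff_norm] at hy
      have hym : y ∈ Metric.ball (0 : ℂ) (12 * d) := by rw [mem_ball_zero_iff]; linarith
      rw [le_div_iff₀ (by positivity)]
      refine le_trans ?_ (hb y hym)
      rw [hfg y hym, norm_mul, norm_prod]
      gcongr
      calc (2 : ℝ) ^ n = ∏ i : Fin n, 2 := by simp
        _ ≤ _ := by
          apply Finset.prod_le_prod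
          · intros; norm_num
          · intro i _
            obtain ⟨h1, h2, _⟩ := hρ i
            have h3 : 0 < ‖ρ i‖ := norm_pos_iff.mpr h2
            have h4 : 3 ≤ ‖y / ρ i‖ := by
              rw [norm_div, le_div_iff₀ h3, hy]; linarith
            have := norm_sub_norm_le (y / ρ i) 1
            rw [norm_sub_rev, norm_one] at this
            linarith
    · rw [closure_ball _ (by positivity)]; exact hz

lemma local_decomp (f : ℂ → ℂ) (d M : ℝ) (hd : 0 < d) (hM : 0 < M)
    (hdiff : DifferentiableOn ℂ f (Metric.ball 0 (12 * d))) (hf0 : f 0 ≠ 0)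
    (hb : ∀ z ∈ Metric.ball (0 : ℂ) (12 * d), ‖f z‖ ≤ Real.exp M * ‖f 0‖) :
    ∃ (n : ℕ) (ρ : Fin n → ℂ), (∀ i, ‖ρ i‖ ≤ 2 * d ∧ ρ i ≠ 0 ∧ f (ρ i) = 0) ∧
      (∀ z, ‖z‖ ≤ 2 * d → f z = 0 → ∃ i, ρ i = z) ∧
      ∀ s, ‖s‖ ≤ d → f s ≠ 0 → ‖deriv f s / f s - ∑ i, 1 / (s - ρ i)‖ ≤ 12 * M / d := by
  have hex : ∃ n, zfac f d n ∧ ¬ zfac f d (n + 1) := by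
    by_contra hcon
    push Not at hcon
    have hall : ∀ n, zfac f d n := by
      intro n
      induction n with
      | zero => exact ⟨Fin.elim0, f, fun i => i.elim0, hdiff, by simp⟩
      | succ n ih => exact hcon n ih
    obtain ⟨n, hn⟩ := pow_unbounded_of_one_lt (Real.exp M) (by norm_num : (1 : ℝ) < 2)
    obtain ⟨ρ, g, h1, h2, h3⟩ := hall n
    obtain ⟨h4, h5⟩ := zfac_max f d hd n ρ g M hb h1 h2 h3
    have h6 := h5 0 (by simp [hd.le])
    rw [h4, mul_comm] at h6
    have := le_of_mul_le_mul_right h6 (norm_pos_iff.mpr hf0)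
    linarith
  obtain ⟨n, ⟨ρ, g, hρ, hg, hfg⟩, hn⟩ := hex
  have hgne : ∀ w, ‖w‖ ≤ 2 * d → g w ≠ 0 := fun w hw hgw =>
    hn (zfac_succ f d hd hf0 n ρ g hρ hg hfg w hw hgw)
  obtain ⟨h4, h5⟩ := zfac_max f d hd n ρ g M hb hρ hg hfg
  refine ⟨n, ρ, hρ, ?_, ?_⟩
  · intro z hz hfz
    have hzm : z ∈ Metric.ball (0 : ℂ) (12 * d) := by rw [mem_ball_zero_iff]; linarith
    rw [hfg z hzm] at hfz
    rcases mul_eq_zero.mp hfz with h | h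
    · exact absurd h (hgne z hz)
    · rw [Finset.prod_eq_zero_iff] at h
      obtain ⟨i, _, hi⟩ := h
      refine ⟨i, ?_⟩
      have := (hρ i).2.1
      rw [sub_eq_zero, eq_comm, div_eq_one_iff_eq this] at hi
      exact hi.symm
  · intro s hs hfs
    have hsm : s ∈ Metric.ball (0 : ℂ) (12 * d) := by rw [mem_ball_zero_iff]; linarith
    have hb1 := logDeriv_bound_nonvanishing g d M hd hM
      (hg.mono (Metric.ball_subset_ball (by linarith)))
      (fun z hz => hgne z (by rw [mem_ball_zero_iff] at hz; exact hz.le))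
      (fun z hz => by
        rw [mem_ball_zero_iff] at hz
        have := h5 z (by rw [mem_closedBall_zero_iff]; linarith)
        rw [h4]
        have h2 : (1 : ℝ) ≤ 2 ^ n := one_le_pow₀ (by norm_num)
        nlinarith [norm_nonneg (g z)]) s hs
    refine le_trans (le_of_eq ?_) hb1
    congr 1
    have hev : f =ᶠ[𝓝 s] fun z => g z * ∏ i, (1 - z / ρ i) := by
      filter_upwards [Metric.isOpen_ball.mem_nhds hsm] with z hz using hfg z hz
    have e1 : deriv f s / f s = logDeriv (fun z => g z * ∏ i, (1 - z / ρ i)) s := by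
      rw [logDeriv_apply, hev.deriv_eq, hfg s hsm]
    have hfs' := hfs
    rw [hfg s hsm] at hfs'
    have hp := right_ne_zero_of_mul hfs'
    have hpi : ∀ i, 1 - s / ρ i ≠ 0 := fun i => (Finset.prod_ne_zero_iff.mp hp) i (Finset.mem_univ i)
    rw [e1, logDeriv_mul s (left_ne_zero_of_mul hfs') hp
      (hg.differentiableAt (Metric.isOpen_ball.mem_nhds hsm)) (by fun_prop)]
    have e2 : logDeriv (fun z => ∏ i, (1 - z / ρ i)) s = ∑ i, 1 / (s - ρ i) := by
      rw [logDeriv_prod (s := Finset.univ) (f := fun i z => 1 - z / ρ i) (x := s) (fun i _ => hpi i) (by intros; fun_prop)]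
      apply Finset.sum_congr rfl
      intro i _
      rw [logDeriv_apply]
      have h1 := (hρ i).2.1
      have h2 := hpi i
      have h3 : s - ρ i ≠ 0 := by
        intro h; apply h2; rw [sub_eq_zero] at h; rw [h, div_self h1, sub_self]
      have : HasDerivAt (fun z => 1 - z / ρ i) (-(1 / ρ i)) s := by
        simpa using ((hasDerivAt_id s).div_const (ρ i)).const_sub 1
      rw [this.deriv]
      have h5 : ρ i - s ≠ 0 := by rw [← neg_sub]; exact neg_ne_zero.mpr h3
      field_simp
      ring
    rw [e2, logDeriv_apply, add_sub_cancel_right]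

lemma local_landau (f : ℂ → ℂ) (d M : ℝ) (hd : 0 < d) (hM : 0 < M)
    (hdiff : DifferentiableOn ℂ f (Metric.ball 0 (12 * d))) (hf0 : f 0 ≠ 0)
    (hb : ∀ z ∈ Metric.ball (0 : ℂ) (12 * d), ‖f z‖ ≤ Real.exp M * ‖f 0‖)
    (hz : ∀ z, ‖z‖ ≤ 2 * d → f z = 0 → z.re ≤ 0) :
    -(deriv f 0 / f 0).re ≤ 12 * M / d ∧
    (∀ x : ℝ, 0 < x → x ≤ 2 * d → f (-x) = 0 → -(deriv f 0 / f 0).re ≤ 12 * M / d - 1 / x) ∧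
    (∀ η : ℝ, 0 < η → η ≤ d → (∀ z, ‖z‖ ≤ 2 * d → f z = 0 → z.re ≤ -(2 * η)) → f (-η) ≠ 0 →
      ‖deriv f (-η) / f (-η)‖ ≤ 36 * M / d + 2 * ‖deriv f 0 / f 0‖) := by
  obtain ⟨n, ρ, hρ, hall, hdec⟩ := local_decomp f d M hd hM hdiff hf0 hb
  have h0 := hdec 0 (by simp [hd.le]) hf0
  have hre := (Complex.abs_re_le_norm _).trans h0
  rw [sub_re, re_sum] at hre
  have hq : ∀ i, (1 / (0 - ρ i)).re = -(ρ i).re / ‖ρ i‖ ^ 2 := by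
    intro i
    rw [zero_sub, one_div, Complex.inv_re, Complex.normSq_eq_norm_sq, norm_neg, neg_re]
  have hq0 : ∀ i, 0 ≤ (1 / (0 - ρ i)).re := by
    intro i
    rw [hq i]
    have := hz _ (hρ i).1 (hρ i).2.2
    apply div_nonneg <;> [linarith; positivity]
  have hsum0 : 0 ≤ ∑ i, (1 / (0 - ρ i)).re := Finset.sum_nonneg (fun i _ => hq0 i)
  have hre' := abs_le.mp hre
  refine ⟨by linarith, ?_, ?_⟩
  · intro x hx hxd hfx
    obtain ⟨i, hi⟩ := hall (-x) (by simpa [abs_of_pos hx] using hxd) hfx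
    have h1 : (1 / (0 - ρ i)).re = 1 / x := by
      rw [hi]; norm_num
    have h2 := Finset.single_le_sum (fun i _ => hq0 i) (Finset.mem_univ i)
    rw [h1] at h2
    linarith
  · intro η hη hηd hz2 hfη
    have h1 := hdec (-η) (by simpa [abs_of_pos hη] using hηd) hfη
    have h2 : ‖∑ i, 1 / (-(η : ℂ) - ρ i) - ∑ i, 1 / (0 - ρ i)‖ ≤ ∑ i, (1 / (0 - ρ i)).re := by
      rw [← Finset.sum_sub_distrib]
      refine norm_sum_le_of_le _ (fun i _ => ?_)
      rw [hq i]
      have h3 := hz2 _ (hρ i).1 (hρ i).2.2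
      have hρ0 := (hρ i).2.1
      have hpos : 0 < ‖ρ i‖ := norm_pos_iff.mpr hρ0
      have h4 : 2 * η ≤ ‖ρ i‖ := by
        have := Complex.abs_re_le_norm (ρ i)
        have := neg_le_abs (ρ i).re
        linarith
      have h5 : ‖ρ i‖ / 2 ≤ ‖ρ i + η‖ := by
        have := norm_sub_norm_le (ρ i) (-(η : ℂ))
        rw [norm_neg, Complex.norm_real, Real.norm_of_nonneg hη.le, sub_neg_eq_add] at this
        linarith
      have h6 : ρ i + η ≠ 0 := by
        rw [← norm_pos_iff]; linarith
      have h6' : -(η : ℂ) - ρ i ≠ 0 := by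
        rw [← neg_add', add_comm]; exact neg_ne_zero.mpr h6
      have e : 1 / (-(η : ℂ) - ρ i) - 1 / (0 - ρ i) = η / ((ρ i + η) * ρ i) := by
        rw [zero_sub]
        field_simp
        ring
      rw [e, norm_div, norm_mul, Complex.norm_real, Real.norm_of_nonneg hη.le,
        div_le_div_iff₀ (by positivity) (by positivity)]
      calc η * ‖ρ i‖ ^ 2 = (2 * η) * (‖ρ i‖ / 2 * ‖ρ i‖) := by ring
        _ ≤ -(ρ i).re * (‖ρ i + η‖ * ‖ρ i‖) := by
          gcongr
          · linarith
          · linarith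
    have h3 : ‖deriv f (-η) / f (-η)‖ ≤ ‖deriv f (-η) / f (-η) - ∑ i, 1 / (-(η : ℂ) - ρ i)‖ +
        ‖∑ i, 1 / (-(η : ℂ) - ρ i) - ∑ i, 1 / (0 - ρ i)‖ +
        ‖deriv f 0 / f 0 - ∑ i, 1 / (0 - ρ i)‖ + ‖deriv f 0 / f 0‖ := by
      set a := deriv f (-η) / f (-η)
      set b := ∑ i, 1 / (-(η : ℂ) - ρ i)
      set c := ∑ i, 1 / (0 - ρ i)
      set e := deriv f 0 / f 0
      have : a = (a - b) + (b - c) + (-(e - c)) + e := by ring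
      calc ‖a‖ = ‖(a - b) + (b - c) + (-(e - c)) + e‖ := by rw [← this]
        _ ≤ ‖a - b‖ + ‖b - c‖ + ‖-(e - c)‖ + ‖e‖ := norm_add₄_le
        _ = _ := by rw [norm_neg]
    have h7 : (deriv f 0 / f 0).re ≤ ‖deriv f 0 / f 0‖ := Complex.re_le_norm _
    have h8 : 36 * M / d = 12 * M / d + 12 * M / d + 12 * M / d := by ring
    linarith

lemma zeta_ld_real : ∃ A ε : ℝ, 0 < A ∧ 0 < ε ∧ ∀ δ : ℝ, 0 < δ → δ < ε →
    ‖deriv riemannZeta (1 + δ) / riemannZeta (1 + δ)‖ ≤ 1 / δ + A := by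
  obtain ⟨A, hA, h⟩ := log_deriv_riemannZeta_add_inv_sub_bounded.exists_pos
  rw [Asymptotics.isBigOWith_iff, eventually_nhdsWithin_iff, Metric.eventually_nhds_iff] at h
  obtain ⟨ε, hε, h⟩ := h
  refine ⟨A, ε, hA, hε, fun δ hδ hδε => ?_⟩
  have h1 := h (y := 1 + δ) (by simpa [dist_eq_norm, abs_of_pos hδ] using hδε) (by
    simp only [Set.mem_compl_iff, Set.mem_singleton_iff, add_eq_left]
    exact_mod_cast hδ.ne')
  simp only [norm_one, mul_one, add_sub_cancel_left] at h1
  have h2 := norm_sub_le (deriv riemannZeta (1 + δ) / riemannZeta (1 + δ) + (δ : ℂ)⁻¹) ((δ : ℂ)⁻¹)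
  rw [add_sub_cancel_right, norm_inv, Complex.norm_real, Real.norm_of_nonneg hδ.le] at h2
  rw [one_div]
  linarith

open ArithmeticFunction in
lemma zeta_ld_norm (σ t : ℝ) (hσ : 1 < σ) :
    ‖deriv riemannZeta (σ + t * I) / riemannZeta (σ + t * I)‖ ≤ ‖deriv riemannZeta σ / riemannZeta σ‖ := by
  have hre : 1 < ((σ : ℂ) + t * I).re := by simpa using hσ
  have hre' : 1 < (σ : ℂ).re := by simpa using hσ
  have e1 := LSeries_vonMangoldt_eq_deriv_riemannZeta_div hre
  have e2 := LSeries_vonMangoldt_eq_deriv_riemannZeta_div hre'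
  rw [← norm_neg, ← norm_neg (deriv riemannZeta σ / riemannZeta σ), ← neg_div, ← neg_div, ← e1, ← e2]
  have s1 := LSeriesSummable_vonMangoldt hre
  have s2 := LSeriesSummable_vonMangoldt hre'
  have e3 : ∀ n, ‖LSeries.term (fun n : ℕ => ((ArithmeticFunction.vonMangoldt n : ℝ) : ℂ)) (σ + t * I) n‖ = (LSeries.term (fun n : ℕ => ((ArithmeticFunction.vonMangoldt n : ℝ) : ℂ)) σ n).re := by
    intro n
    rcases Nat.eq_zero_or_pos n with rfl | hn
    · simp
    · rw [LSeries.norm_term_eq]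
      rw [if_neg hn.ne', LSeries.term_of_ne_zero hn.ne']
      have h1 : ((n : ℂ) ^ (σ : ℂ)) = (((n : ℝ) ^ σ : ℝ) : ℂ) := by
        rw [Complex.ofReal_cpow (by positivity)]; simp
      rw [h1, ← Complex.ofReal_div, Complex.ofReal_re]
      simp [abs_of_nonneg (vonMangoldt_nonneg (n := n))]
  calc ‖LSeries (fun n : ℕ => ((ArithmeticFunction.vonMangoldt n : ℝ) : ℂ)) (σ + t * I)‖ ≤ ∑' n, ‖LSeries.term (fun n : ℕ => ((ArithmeticFunction.vonMangoldt n : ℝ) : ℂ)) (σ + t * I) n‖ := norm_tsum_le_tsum_norm s1.norm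
    _ = ∑' n, (LSeries.term (fun n : ℕ => ((ArithmeticFunction.vonMangoldt n : ℝ) : ℂ)) σ n).re := by simp_rw [e3]
    _ = (LSeries (fun n : ℕ => ((ArithmeticFunction.vonMangoldt n : ℝ) : ℂ)) σ).re := (Complex.re_tsum s2).symm
    _ ≤ ‖LSeries (fun n : ℕ => ((ArithmeticFunction.vonMangoldt n : ℝ) : ℂ)) σ‖ := Complex.re_le_norm _

open ArithmeticFunction in
lemma zeta_341 (σ t : ℝ) (hσ : 1 < σ) :
    0 ≤ 3 * (-(deriv riemannZeta σ / riemannZeta σ).re) +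
      4 * (-(deriv riemannZeta (σ + t * I) / riemannZeta (σ + t * I)).re) +
      (-(deriv riemannZeta (σ + (2 * t : ℝ) * I) / riemannZeta (σ + (2 * t : ℝ) * I)).re) := by
  have hre0 : 1 < (σ : ℂ).re := by simpa using hσ
  have hre1 : 1 < ((σ : ℂ) + t * I).re := by simpa using hσ
  have hre2 : 1 < ((σ : ℂ) + (2 * t : ℝ) * I).re := by simpa using hσ
  rw [← neg_re, ← neg_re, ← neg_re, ← neg_div, ← neg_div, ← neg_div,
    ← LSeries_vonMangoldt_eq_deriv_riemannZeta_div hre0,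
    ← LSeries_vonMangoldt_eq_deriv_riemannZeta_div hre1,
    ← LSeries_vonMangoldt_eq_deriv_riemannZeta_div hre2]
  have s0 := (Complex.hasSum_re (LSeriesSummable_vonMangoldt hre0).hasSum).mul_left 3
  have s1 := (Complex.hasSum_re (LSeriesSummable_vonMangoldt hre1).hasSum).mul_left 4
  have s2 := Complex.hasSum_re (LSeriesSummable_vonMangoldt hre2).hasSum
  refine ((s0.add s1).add s2).nonneg ?_
  intro n
  rcases Nat.eq_zero_or_pos n with rfl | hn
  · simp
  · have hn0 : (n : ℂ) ≠ 0 := by exact_mod_cast hn.ne'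
    have hnr : (0 : ℝ) < n := by exact_mod_cast hn
    have h1 : ((n : ℂ) ^ (σ : ℂ)) = (((n : ℝ) ^ σ : ℝ) : ℂ) := by
      rw [Complex.ofReal_cpow (by positivity)]; simp
    set u : ℂ := (n : ℂ) ^ (-(t * I)) with hu
    have hun : ‖u‖ = 1 := by
      have := Complex.norm_cpow_eq_rpow_re_of_pos hnr (-(t * I))
      simpa using this
    have e1 : (LSeries.term (fun n : ℕ => ((ArithmeticFunction.vonMangoldt n : ℝ) : ℂ)) (σ + t * I) n) = ((vonMangoldt n / (n : ℝ) ^ σ : ℝ) : ℂ) * u := by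
      rw [LSeries.term_of_ne_zero hn.ne', Complex.cpow_add _ _ hn0, h1, hu, Complex.cpow_neg]
      push_cast
      field_simp
    have e2 : (LSeries.term (fun n : ℕ => ((ArithmeticFunction.vonMangoldt n : ℝ) : ℂ)) (σ + (2 * t : ℝ) * I) n) = ((vonMangoldt n / (n : ℝ) ^ σ : ℝ) : ℂ) * u ^ 2 := by
      have : ((2 * t : ℝ) : ℂ) * I = t * I + t * I := by push_cast; ring
      rw [LSeries.term_of_ne_zero hn.ne', Complex.cpow_add _ _ hn0, h1, hu, this, Complex.cpow_neg,
        Complex.cpow_add _ _ hn0]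
      push_cast
      field_simp
    have e0 : (LSeries.term (fun n : ℕ => ((ArithmeticFunction.vonMangoldt n : ℝ) : ℂ)) σ n) = ((vonMangoldt n / (n : ℝ) ^ σ : ℝ) : ℂ) := by
      rw [LSeries.term_of_ne_zero hn.ne', h1]
      push_cast
      rfl
    rw [e0, e1, e2, Complex.re_ofReal_mul, Complex.re_ofReal_mul, Complex.ofReal_re]
    have hΛ : 0 ≤ vonMangoldt n / (n : ℝ) ^ σ := div_nonneg vonMangoldt_nonneg (by positivity)
    have hsq : u.re ^ 2 + u.im ^ 2 = 1 := by
      have := Complex.normSq_eq_norm_sq u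
      rw [hun, Complex.normSq_apply] at this
      nlinarith
    have : (u ^ 2).re = u.re ^ 2 - u.im ^ 2 := by rw [pow_two, Complex.mul_re]; ring
    rw [this]
    have : 3 * (vonMangoldt n / (n : ℝ) ^ σ) + 4 * (vonMangoldt n / (n : ℝ) ^ σ * u.re) + vonMangoldt n / (n : ℝ) ^ σ * (u.re ^ 2 - u.im ^ 2) =
      (vonMangoldt n / (n : ℝ) ^ σ) * (2 * (1 + u.re) ^ 2) := by
      have : u.im ^ 2 = 1 - u.re ^ 2 := by linarith
      rw [this]; ring
    rw [this]
    positivity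

open ArithmeticFunction in
lemma zeta_lower : ∃ c : ℝ, 0 < c ∧ ∀ x t : ℝ, 0 < x → x ≤ 1 →
    c * x ≤ ‖riemannZeta (((1 + x : ℝ) : ℂ) + t * I)‖ := by
  obtain ⟨C0, hC0, happ⟩ := zeta_approx
  refine ⟨1 / (1 + 2 * C0), by positivity, ?_⟩
  intro x t hx hx1
  have hre : 1 < (((1 + x : ℝ) : ℂ) + t * I).re := by simpa using hx
  have hre' : 1 < ((1 + x : ℝ) : ℂ).re := by simpa using hx
  have h1 := LSeries_one_mul_Lseries_moebius hre
  rw [LSeries_one_eq_riemannZeta hre] at h1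
  have s1 : LSeriesSummable (1 : ℕ → ℂ) ((1 + x : ℝ) : ℂ) := LSeriesSummable_one_iff.mpr hre'
  have hle : ∀ n, ‖LSeries.term (fun n : ℕ => ((ArithmeticFunction.moebius n : ℤ) : ℂ)) (((1 + x : ℝ) : ℂ) + t * I) n‖ ≤ (LSeries.term 1 ((1 + x : ℝ) : ℂ) n).re := by
    intro n
    rcases Nat.eq_zero_or_pos n with rfl | hn
    · simp
    · rw [LSeries.norm_term_eq]
      rw [if_neg hn.ne', LSeries.term_of_ne_zero hn.ne']
      have h1 : ((n : ℂ) ^ ((1 + x : ℝ) : ℂ)) = (((n : ℝ) ^ (1 + x) : ℝ) : ℂ) := by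
        rw [Complex.ofReal_cpow (by positivity)]; simp
      have h2 : ((1 : ℕ → ℂ) n) = ((1 : ℝ) : ℂ) := by simp
      rw [h1, h2, ← Complex.ofReal_div, Complex.ofReal_re]
      have h3 : (((1 + x : ℝ) : ℂ) + t * I).re = 1 + x := by simp
      rw [h3]
      gcongr
      have : |ArithmeticFunction.moebius n| ≤ 1 := abs_moebius_le_one
      have h4 : ‖((ArithmeticFunction.moebius n : ℤ) : ℂ)‖ = ((|ArithmeticFunction.moebius n| : ℤ) : ℝ) := by
        rw [Complex.norm_intCast]; push_cast; rfl
      rw [h4]; exact_mod_cast this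
  have hμ : ‖LSeries (fun n : ℕ => ((ArithmeticFunction.moebius n : ℤ) : ℂ)) (((1 + x : ℝ) : ℂ) + t * I)‖ ≤ ‖riemannZeta ((1 + x : ℝ) : ℂ)‖ := by
    have hs := (Complex.hasSum_re s1.hasSum).summable
    have hsm : Summable (fun n => ‖LSeries.term (fun n : ℕ => ((ArithmeticFunction.moebius n : ℤ) : ℂ)) (((1 + x : ℝ) : ℂ) + t * I) n‖) :=
      hs.of_nonneg_of_le (fun _ => norm_nonneg _) hle
    calc ‖LSeries (fun n : ℕ => ((ArithmeticFunction.moebius n : ℤ) : ℂ)) (((1 + x : ℝ) : ℂ) + t * I)‖ ≤ ∑' n, ‖LSeries.term (fun n : ℕ => ((ArithmeticFunction.moebius n : ℤ) : ℂ)) (((1 + x : ℝ) : ℂ) + t * I) n‖ :=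
          norm_tsum_le_tsum_norm hsm
      _ ≤ ∑' n, (LSeries.term 1 ((1 + x : ℝ) : ℂ) n).re := hsm.tsum_le_tsum hle hs
      _ = (LSeries 1 ((1 + x : ℝ) : ℂ)).re := (Complex.re_tsum s1).symm
      _ = (riemannZeta ((1 + x : ℝ) : ℂ)).re := by rw [LSeries_one_eq_riemannZeta hre']
      _ ≤ _ := Complex.re_le_norm _
  have hz : ‖riemannZeta ((1 + x : ℝ) : ℂ)‖ ≤ (1 + 2 * C0) / x := by
    have hne : ((1 + x : ℝ) : ℂ) ≠ 1 := by
      exact_mod_cast (by linarith : (1 + x) ≠ 1)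
    have h2 := happ 1 ((1 + x : ℝ) : ℂ) le_rfl (by rw [Complex.ofReal_re]; linarith) hne
    have hn0 : -((1 + x : ℝ) : ℂ) ≠ 0 := by
      apply neg_ne_zero.mpr; exact_mod_cast (by linarith : (1 + x) ≠ 0)
    simp only [Finset.range_one, Finset.sum_singleton, Nat.cast_zero, Complex.zero_cpow hn0, sub_zero,
      Nat.cast_one, Complex.one_cpow, Real.one_rpow, mul_one] at h2
    have e1 : ((1 + x : ℝ) : ℂ) - 1 = (x : ℂ) := by push_cast; ring
    rw [e1, Complex.norm_real, Real.norm_of_nonneg (by linarith)] at h2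
    have h3 := norm_sub_norm_le (riemannZeta ((1 + x : ℝ) : ℂ)) (1 / (x : ℂ))
    rw [norm_div, norm_one, Complex.norm_real, Real.norm_of_nonneg hx.le] at h3
    have h4 : C0 * (1 + x) ≤ 2 * C0 / x := by
      rw [le_div_iff₀ hx]
      have : (1 + x) * x ≤ 2 := by nlinarith
      nlinarith
    have : (1 + 2 * C0) / x = 1 / x + 2 * C0 / x := by ring
    linarith
  have h5 : 1 = ‖riemannZeta (((1 + x : ℝ) : ℂ) + t * I)‖ * ‖LSeries (fun n : ℕ => ((ArithmeticFunction.moebius n : ℤ) : ℂ)) (((1 + x : ℝ) : ℂ) + t * I)‖ := by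
    rw [← norm_mul, h1, norm_one]
  have h6 : 1 ≤ ‖riemannZeta (((1 + x : ℝ) : ℂ) + t * I)‖ * ((1 + 2 * C0) / x) := by
    exact h5.le.trans (mul_le_mul_of_nonneg_left (hμ.trans hz) (norm_nonneg _))
  rw [← mul_div_assoc, le_div_iff₀ hx] at h6
  rw [one_div, ← div_eq_inv_mul, div_le_iff₀ (by positivity)]
  linarith

lemma zeta_local (θ X M δ γ : ℝ) (hθ : 0 < θ) (hθ1 : θ ≤ 1) (hδ : 0 < δ) (hδ1 : δ ≤ 1) (hγ : 2 ≤ γ) (hM : 0 < M)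
    (hX : ∀ σ u : ℝ, 1 - θ ≤ σ → σ ≤ 3 → |u - γ| ≤ 1 → ‖riemannZeta (σ + u * I)‖ ≤ X)
    (hXM : X ≤ Real.exp M * ‖riemannZeta (((1 + δ : ℝ) : ℂ) + γ * I)‖) (c : ℂ) (hc : c = ((1 + δ : ℝ) : ℂ) + γ * I) :
    -(deriv riemannZeta c / riemannZeta c).re ≤ 144 * M / θ ∧
    (∀ x : ℝ, 0 < x → x ≤ θ / 6 → riemannZeta (c - x) = 0 →
      -(deriv riemannZeta c / riemannZeta c).re ≤ 144 * M / θ - 1 / x) ∧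
    (∀ η : ℝ, 0 < η → η ≤ θ / 12 → (∀ z, ‖z‖ ≤ θ / 6 → riemannZeta (c + z) = 0 → z.re ≤ -(2 * η)) →
      riemannZeta (c - η) ≠ 0 →
      ‖deriv riemannZeta (c - η) / riemannZeta (c - η)‖ ≤
        432 * M / θ + 2 * ‖deriv riemannZeta c / riemannZeta c‖) := by
  have hcre : c.re = 1 + δ := by rw [hc]; simp
  have hcim : c.im = γ := by rw [hc]; simp
  have hd : 0 < θ / 12 := by positivity
  have e12 : 12 * (θ / 12) = θ := by ring
  have e2 : 2 * (θ / 12) = θ / 6 := by ring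
  have key := local_landau (fun z => riemannZeta (c + z)) (θ / 12) M hd hM ?_ ?_ ?_ ?_
  · have eM : 12 * M / (θ / 12) = 144 * M / θ := by field_simp; norm_num
    have eM3 : 36 * M / (θ / 12) = 432 * M / θ := by field_simp; norm_num
    simp only [deriv_comp_const_add, add_zero, e2, eM, eM3, ← sub_eq_add_neg] at key
    exact key
  · rw [e12]
    intro z hz
    rw [mem_ball_zero_iff] at hz
    have hne : c + z ≠ 1 := by
      intro h
      have h2 := congrArg Complex.im h
      rw [add_im, hcim, one_im] at h2
      have := Complex.abs_im_le_norm z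
      have := neg_abs_le z.im
      linarith
    have h1 : DifferentiableAt ℂ riemannZeta (c + z) := differentiableAt_riemannZeta hne
    exact (DifferentiableAt.comp z h1 (by fun_prop)).differentiableWithinAt
  · simp only [add_zero]
    exact riemannZeta_ne_zero_of_one_le_re (by rw [hcre]; linarith)
  · rw [e12]
    intro z hz
    rw [mem_ball_zero_iff] at hz
    simp only [add_zero]
    rw [← hc] at hXM
    refine le_trans ?_ hXM
    have h1 := abs_le.mp (Complex.abs_re_le_norm z)
    have h2 := Complex.abs_im_le_norm z
    have := hX (c + z).re (c + z).im (by rw [add_re, hcre]; linarith) (by rw [add_re, hcre]; linarith)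
      (by rw [add_im, hcim, add_sub_cancel_left]; linarith)
    rwa [Complex.re_add_im] at this
  · intro z _ hfz
    by_contra hcon
    push Not at hcon
    exact riemannZeta_ne_zero_of_one_le_re (by rw [add_re, hcre]; linarith) hfz

lemma zeta_abs (A ε c : ℝ) (hA : 0 < A) (hc : 0 < c)
    (hreal : ∀ δ : ℝ, 0 < δ → δ < ε → ‖deriv riemannZeta (1 + δ) / riemannZeta (1 + δ)‖ ≤ 1 / δ + A)
    (hlow : ∀ x t : ℝ, 0 < x → x ≤ 1 → c * x ≤ ‖riemannZeta (((1 + x : ℝ) : ℂ) + t * I)‖)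
    (θ X M δ t : ℝ) (hθ : 0 < θ) (hθ1 : θ ≤ 1) (hδ : 0 < δ) (hδε : δ < ε) (hM : 1 ≤ M) (ht : 10 ≤ t)
    (hX : ∀ σ u : ℝ, 1 - θ ≤ σ → σ ≤ 3 → t / 2 ≤ u → u ≤ 4 * t → ‖riemannZeta (σ + u * I)‖ ≤ X)
    (hXM : X ≤ Real.exp M * (c * (δ / 7))) (hδM : δ * (6 * A + 1440 * M / θ) ≤ 1) :
    ‖deriv riemannZeta (1 + t * I) / riemannZeta (1 + t * I)‖ ≤ 432 * M / θ + 2 * (7 / δ + A) := by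
  have hM0 : 0 < M := by linarith
  have hδθ : δ ≤ θ / 1440 := by
    have h1 : δ * (1440 * M / θ) ≤ 1 := by nlinarith
    rw [← mul_div_assoc, div_le_one hθ] at h1
    have : δ * 1 ≤ δ * M := by gcongr
    linarith
  have hδ1 : δ ≤ 1 := by linarith
  set Q := 144 * M / θ with hQ
  have hQ10 : 1440 * M / θ = 10 * Q := by rw [hQ]; ring
  rw [hQ10] at hδM
  have hAQ : 6 * A + 10 * Q ≤ 1 / δ := by
    rw [le_div_iff₀ hδ]; linarith
  have hcδ : ∀ x u : ℝ, δ / 7 ≤ x → x ≤ 1 → X ≤ Real.exp M * ‖riemannZeta (((1 + x : ℝ) : ℂ) + u * I)‖ := by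
    intro x u hx hx1
    refine hXM.trans ?_
    gcongr
    refine le_trans ?_ (hlow x u (by linarith) hx1)
    gcongr
  have hldx : ∀ x u : ℝ, 0 < x → x < ε →
      ‖deriv riemannZeta (((1 + x : ℝ) : ℂ) + u * I) / riemannZeta (((1 + x : ℝ) : ℂ) + u * I)‖ ≤ 1 / x + A := by
    intro x u hx hxε
    refine (zeta_ld_norm (1 + x) u (by linarith)).trans ?_
    have := hreal x hx hxε
    push_cast
    exact this
  have hzf : ∀ β γ : ℝ, |γ - t| ≤ 1 → riemannZeta (β + γ * I) = 0 → β ≤ 1 - δ / 7 := by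
    intro β γ hγ hz
    by_contra hcon
    push Not at hcon
    have hγ' := abs_le.mp hγ
    have hβ1 : β < 1 := by
      by_contra h
      push Not at h
      exact riemannZeta_ne_zero_of_one_le_re (by simpa using h) hz
    have l1 := (zeta_local θ X M δ γ hθ hθ1 hδ hδ1 (by linarith) hM0 (fun σ u h1 h2 h3 => by
      have := abs_le.mp h3
      exact hX σ u h1 h2 (by linarith) (by linarith)) (hcδ δ γ (by linarith) hδ1) _ rfl).2.1
      (1 + δ - β) (by linarith) (by linarith) (by
        rw [← hz]; congr 1; push_cast; ring)
    have l2 := (zeta_local θ X M δ (2 * γ) hθ hθ1 hδ hδ1 (by linarith) hM0 (fun σ u h1 h2 h3 => by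
      have := abs_le.mp h3
      exact hX σ u h1 h2 (by linarith) (by linarith)) (hcδ δ (2 * γ) (by linarith) hδ1) _ rfl).1
    have l3 := zeta_341 (1 + δ) γ (by linarith)
    have l4 : -(deriv riemannZeta ((1 + δ : ℝ) : ℂ) / riemannZeta ((1 + δ : ℝ) : ℂ)).re ≤ 1 / δ + A := by
      have h1 := hreal δ hδ hδε
      have h2 := neg_le_of_abs_le (Complex.abs_re_le_norm
        (deriv riemannZeta ((1 + δ : ℝ) : ℂ) / riemannZeta ((1 + δ : ℝ) : ℂ)))
      push_cast at h2 ⊢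
      linarith
    have l5 : 4 * (1 / (1 + δ - β)) ≤ 7 / 2 * (1 / δ) := by
      rw [← hQ] at l1 l2
      linarith
    have l6 : 1 / (8 / 7 * δ) < 1 / (1 + δ - β) := by
      apply one_div_lt_one_div_of_lt <;> linarith
    have l7 : 1 / (8 / 7 * δ) = 7 / 8 * (1 / δ) := by field_simp
    linarith
  have l := (zeta_local θ X M (δ / 7) t hθ hθ1 (by linarith) (by linarith) (by linarith) hM0 (fun σ u h1 h2 h3 => by
      have := abs_le.mp h3
      exact hX σ u h1 h2 (by linarith) (by linarith)) (hcδ (δ / 7) t (by linarith) (by linarith)) _ rfl).2.2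
      (δ / 7) (by linarith) (by linarith) (by
        intro z hz hfz
        have e : ((1 + δ / 7 : ℝ) : ℂ) + t * I + z = ((1 + δ / 7 + z.re : ℝ) : ℂ) + ((t + z.im : ℝ) : ℂ) * I := by
          apply Complex.ext <;> simp
        rw [e] at hfz
        have := hzf _ _ (by
          rw [add_sub_cancel_left]
          have := Complex.abs_im_le_norm z
          linarith) hfz
        linarith)
  have e : ((1 + δ / 7 : ℝ) : ℂ) + t * I - ((δ / 7 : ℝ) : ℂ) = 1 + t * I := by push_cast; ring
  rw [e] at l
  refine (l (riemannZeta_ne_zero_of_one_le_re (by simp))).trans ?_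
  have h1 := hldx (δ / 7) t (by linarith) (by linarith)
  have h2 : 1 / (δ / 7) = 7 / δ := by field_simp
  rw [h2] at h1
  linarith

lemma zeta_ld_bound : ∃ K : ℝ, 0 < K ∧ ∀ᶠ t : ℝ in atTop,
    ‖deriv riemannZeta (1 + t * I) / riemannZeta (1 + t * I)‖ ≤
      K * (Real.log t / Real.log (Real.log t)) := by
  obtain ⟨C, hC, hz⟩ := zeta_bound_pos
  obtain ⟨A, ε, hA, hε, hreal⟩ := zeta_ld_real
  obtain ⟨c, hc, hlow⟩ := zeta_lower
  refine ⟨432 * 17 + 14 * 24480 + 86 * A, by positivity, ?_⟩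
  have hll : Tendsto (fun t : ℝ => Real.log (Real.log t)) atTop atTop :=
    Real.tendsto_log_atTop.comp Real.tendsto_log_atTop
  have hp1 : ∀ᶠ l : ℝ in atTop, 1001 ≤ Real.exp l / l ^ 3 :=
    (Real.tendsto_exp_div_pow_atTop 3).eventually_ge_atTop 1001
  have hp2 : ∀ᶠ l : ℝ in atTop, 96 ≤ Real.exp (l / 2) / (l / 2) ^ 2 :=
    ((Real.tendsto_exp_div_pow_atTop 2).comp (tendsto_id.atTop_div_const (by norm_num : (0 : ℝ) < 2))).eventually_ge_atTop 96
  filter_upwards [hll.eventually hp1, hll.eventually hp2, hll.eventually_ge_atTop 8,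
    hll.eventually_ge_atTop (14 * C * (6 * A + 24480) / c), hll.eventually_ge_atTop (1 / ε),
    eventually_ge_atTop 10] with t h1 h2 h8 hC' hε' ht
  have ht0 : 0 < t := by linarith
  have hL0 : 0 < Real.log t := Real.log_pos (by linarith)
  have hexp : Real.exp (Real.log (Real.log t)) = Real.log t := Real.exp_log hL0
  set l := Real.log (Real.log t) with hl
  set L := Real.log t with hL
  have hl0 : 0 < l := by linarith
  rw [hexp, le_div_iff₀ (by positivity)] at h1
  rw [le_div_iff₀ (by positivity)] at h2
  have hl3 : 512 ≤ l ^ 3 := by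
    calc (512 : ℝ) = 8 ^ 3 := by norm_num
      _ ≤ l ^ 3 := by gcongr
  have hlL : l ≤ L := by
    rw [← hexp]; linarith [Real.add_one_le_exp l]
  set k := ⌊l / 4⌋₊ with hk
  have hk1 : (k : ℝ) ≤ l / 4 := Nat.floor_le (by positivity)
  have hk2 : l / 8 ≤ k := by
    have := Nat.lt_floor_add_one (l / 4)
    rw [← hk] at this
    linarith
  have hk0 : 1 ≤ k := by
    have : (1 : ℝ) ≤ k := by linarith
    exact_mod_cast this
  have hkpos : (0 : ℝ) < k := by exact_mod_cast hk0
  have h4k : (4 : ℝ) ^ k ≤ Real.exp (l / 2) := by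
    rw [← Real.exp_log (by positivity : (0 : ℝ) < 4 ^ k), Real.exp_le_exp, Real.log_pow]
    have : Real.log 4 ≤ 2 := by
      have : (4 : ℝ) = 2 ^ 2 := by norm_num
      rw [this, Real.log_pow]; push_cast; linarith [Real.log_two_lt_d9]
    nlinarith
  have h4k1 : (1 : ℝ) ≤ 4 ^ k := one_le_pow₀ (by norm_num)
  set θ : ℝ := 1 / (8 * 4 ^ k) with hθ
  have hθ0 : 0 < θ := by positivity
  have hθ1 : θ ≤ 1 := by rw [hθ, div_le_one (by positivity)]; linarith
  set Y := θ * L / l with hY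
  have hY3 : 3 * l ≤ Y := by
    rw [hY, le_div_iff₀ hl0, hθ, one_div_mul_eq_div, le_div_iff₀ (by positivity)]
    have e : L = Real.exp (l / 2) * Real.exp (l / 2) := by
      rw [← Real.exp_add, ← hexp]; congr 1; ring
    rw [e]
    calc 3 * l * l * (8 * 4 ^ k) = (96 * (l / 2) ^ 2) * 4 ^ k := by ring
      _ ≤ Real.exp (l / 2) * Real.exp (l / 2) := by gcongr
  have hLl : 3 * l ≤ L / l := by
    refine hY3.trans ?_
    rw [hY]
    gcongr
    nlinarith
  have hMθ : ∀ a : ℝ, a * (17 * Y) / θ = 17 * a * (L / l) := by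
    intro a; rw [hY]; field_simp
  set D := 6 * A + 1440 * (17 * Y) / θ with hD
  have hD' : D = 6 * A + 24480 * (L / l) := by rw [hD, hMθ]; ring
  have hLlpos : 0 < L / l := by positivity
  have hDpos : 0 < D := by rw [hD']; positivity
  have key := zeta_abs A ε c hA hc hreal hlow θ (C * (2 * L) * Real.exp (16 * Y)) (17 * Y) (1 / D) t hθ0 hθ1
    (by positivity) ?_ (by linarith) ht ?_ ?_ ?_
  · refine key.trans ?_
    rw [hMθ, div_div_eq_mul_div, div_one, hD']
    have : 1 ≤ L / l := by linarith
    nlinarith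
  · rw [div_lt_comm₀ hDpos hε, hD']
    nlinarith
  · intro σ u hσ hσ3 hu1 hu2
    have hu0 : 0 < u := by linarith
    have hlu1 : L - 1 ≤ Real.log u := by
      have := Real.log_le_log (by linarith) hu1
      rw [Real.log_div (by linarith) (by norm_num)] at this
      linarith [Real.log_two_lt_d9]
    have hlu2 : Real.log u ≤ 2 * L := by
      have := Real.log_le_log hu0 hu2
      rw [Real.log_mul (by norm_num) (by linarith)] at this
      have h4 : Real.log 4 ≤ 2 := by
        have : (4 : ℝ) = 2 ^ 2 := by norm_num
        rw [this, Real.log_pow]; push_cast; linarith [Real.log_two_lt_d9]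
      linarith
    have hk3 : 60000 * (k : ℝ) ^ 3 ≤ Real.log u := by
      have : (k : ℝ) ^ 3 ≤ (l / 4) ^ 3 := by gcongr
      have e : (l / 4) ^ 3 = l ^ 3 / 64 := by ring
      rw [e] at this
      linarith
    refine (hz k u σ hk0 (by linarith) hk3 hσ hσ3).trans ?_
    have hlu0 : 0 ≤ Real.log u := by linarith
    gcongr
    calc Real.log u / (8 * 4 ^ k * k) = θ * Real.log u / k := by rw [hθ]; field_simp
      _ ≤ θ * (2 * L) / (l / 8) := by gcongr
      _ = 16 * Y := by rw [hY]; field_simp; norm_num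
  · have e1 : Real.exp (17 * Y) = Real.exp (16 * Y) * Real.exp Y := by rw [← Real.exp_add]; congr 1; ring
    rw [e1]
    have hE : L ^ 3 ≤ Real.exp Y := by
      calc L ^ 3 = Real.exp (3 * l) := by rw [← hexp, ← Real.exp_nat_mul]; norm_num
        _ ≤ _ := Real.exp_le_exp.mpr hY3
    have hDL : D ≤ (6 * A + 24480) * L := by
      rw [hD']
      have : L / l ≤ L := div_le_self hL0.le (by linarith)
      nlinarith
    have h3 : C * (2 * L) * (7 * D) ≤ c * Real.exp Y := by
      calc C * (2 * L) * (7 * D) ≤ C * (2 * L) * (7 * ((6 * A + 24480) * L)) := by gcongr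
        _ = c * (14 * C * (6 * A + 24480) / c) * L ^ 2 := by field_simp; ring
        _ ≤ c * L * L ^ 2 := by gcongr; linarith
        _ = c * L ^ 3 := by ring
        _ ≤ _ := by gcongr
    have e2 : Real.exp (16 * Y) * Real.exp Y * (c * (1 / D / 7)) =
        (c * Real.exp Y) / (7 * D) * Real.exp (16 * Y) := by field_simp
    rw [e2]
    gcongr
    rw [le_div_iff₀ (by positivity)]
    exact h3
  · rw [← hD, one_div_mul_cancel hDpos.ne']

lemma ratio_gronwall (φ φ' : ℝ → ℂ) (K : ℝ) (hK : 0 < K)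
    (hd : ∀ x ∈ Set.Icc (0 : ℝ) 1, HasDerivAt φ (φ' x) x) (h0 : φ 0 ≠ 0)
    (hb : ∀ x ∈ Set.Icc (0 : ℝ) 1, ‖φ' x‖ ≤ K * ‖φ x‖) :
    ‖φ 1 / φ 0 - 1‖ ≤ Real.exp K - 1 := by
  have hpos : 0 < ‖φ 0‖ := norm_pos_iff.mpr h0
  have hd2 : ∀ x ∈ Set.Icc (0 : ℝ) 1, HasDerivAt (fun x => φ x / φ 0 - 1) (φ' x / φ 0) x := fun x hx =>
    ((hd x hx).div_const (φ 0)).sub_const 1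
  have := norm_le_gronwallBound_of_norm_deriv_right_le (f := fun x => φ x / φ 0 - 1) (f' := fun x => φ' x / φ 0)
    (δ := 0) (K := K) (ε := K) (a := 0) (b := 1)
    (fun x hx => (hd2 x hx).continuousAt.continuousWithinAt)
    (fun x hx => (hd2 x ⟨hx.1, hx.2.le⟩).hasDerivWithinAt) (by simp [h0]) (fun x hx => by
      have h1 := hb x ⟨hx.1, hx.2.le⟩
      have h2 : ‖φ x / φ 0‖ ≤ ‖φ x / φ 0 - 1‖ + 1 := by
        simpa using norm_add_le (φ x / φ 0 - 1) 1
      rw [norm_div]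
      calc ‖φ' x‖ / ‖φ 0‖ ≤ K * ‖φ x‖ / ‖φ 0‖ := by gcongr
        _ = K * ‖φ x / φ 0‖ := by rw [norm_div]; ring
        _ ≤ K * (‖φ x / φ 0 - 1‖ + 1) := by gcongr
        _ = _ := by ring) 1 (by simp)
  rw [gronwallBound_of_K_ne_0 hK.ne'] at this
  simpa [hK.ne'] using this

lemma omega_facts (r ω : ℕ → ℝ) (hr : Tendsto r atTop atTop) (hωpos : ∀ j, 0 < ω j)
    (hω : Tendsto (fun j => ω j * Real.log (r j) / Real.log (Real.log (r j))) atTop (𝓝 0)) :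
    Tendsto ω atTop (𝓝 0) := by
  have hl := Real.tendsto_log_atTop.comp hr
  have hll := Real.tendsto_log_atTop.comp hl
  refine squeeze_zero' (Eventually.of_forall fun j => (hωpos j).le) ?_ hω
  filter_upwards [hl.eventually_ge_atTop 1, hll.eventually_ge_atTop 1] with j h1 h2
  simp only [Function.comp] at h1 h2
  rw [mul_div_assoc]
  have h3 : Real.log (Real.log (r j)) ≤ Real.log (r j) := by
    linarith [Real.log_le_sub_one_of_pos (by linarith : 0 < Real.log (r j))]
  have : 1 ≤ Real.log (r j) / Real.log (Real.log (r j)) := by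
    rw [le_div_iff₀ (by linarith)]; linarith
  nlinarith [hωpos j]

lemma zeta_ratio (r ω a b : ℕ → ℝ) (hr : Tendsto r atTop atTop) (hωpos : ∀ j, 0 < ω j)
    (hω : Tendsto (fun j => ω j * Real.log (r j) / Real.log (Real.log (r j))) atTop (𝓝 0))
    (ha : ∀ j, |a j - r j| < ω j) (hb : ∀ j, |b j - r j| < ω j) :
    Tendsto (fun j => riemannZeta (1 + 2 * I * (a j : ℂ)) / riemannZeta (1 + 2 * I * (b j : ℂ))) atTop (𝓝 1) := by
  obtain ⟨K, hK, hbd⟩ := zeta_ld_bound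
  obtain ⟨T0, hT0⟩ := eventually_atTop.mp hbd
  have hω0 := omega_facts r ω hr hωpos hω
  have hl := Real.tendsto_log_atTop.comp hr
  have hll := Real.tendsto_log_atTop.comp hl
  rw [tendsto_iff_norm_sub_tendsto_zero]
  have hlim : Tendsto (fun j => Real.exp (8 * K * (ω j * Real.log (r j) / Real.log (Real.log (r j)))) - 1)
      atTop (𝓝 0) := by
    have := ((Real.continuous_exp.tendsto _).comp (hω.const_mul (8 * K))).sub_const 1
    simpa using this
  refine squeeze_zero' (Eventually.of_forall fun j => norm_nonneg _) ?_ hlim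
  filter_upwards [hl.eventually_ge_atTop 2, hll.eventually_ge_atTop 1, hω0.eventually_le_const (zero_lt_one),
    hr.eventually_ge_atTop (max T0 10)] with j h1 h2 h3 h4
  simp only [Function.comp] at h1 h2
  have h5 : T0 ≤ r j := (le_max_left _ _).trans h4
  have h6 : 10 ≤ r j := (le_max_right _ _).trans h4
  have ha' := abs_lt.mp (ha j)
  have hb' := abs_lt.mp (hb j)
  set L := Real.log (r j) with hL
  set l := Real.log L with hl'
  have hωj := hωpos j
  have hpath : ∀ x ∈ Set.Icc (0 : ℝ) 1, r j ≤ 2 * (b j + x * (a j - b j)) ∧ 2 * (b j + x * (a j - b j)) ≤ 4 * r j := by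
    intro x hx
    constructor <;> nlinarith [hx.1, hx.2]
  have key := ratio_gronwall (fun x : ℝ => riemannZeta (1 + ((2 * (b j + x * (a j - b j)) : ℝ) : ℂ) * I))
    (fun x : ℝ => deriv riemannZeta (1 + ((2 * (b j + x * (a j - b j)) : ℝ) : ℂ) * I) * ((2 * (a j - b j) : ℝ) * I))
    (8 * K * (ω j * L / l)) (by positivity) ?_ ?_ ?_
  · refine le_trans (le_of_eq ?_) key
    congr 1
    congr 2
    · congr 1; push_cast; ring
    · congr 1; push_cast; ring
  · intro x hx
    have h7 := hpath x hx
    have hne : (1 + ((2 * (b j + x * (a j - b j)) : ℝ) : ℂ) * I) ≠ 1 := by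
      intro h
      have := congrArg Complex.im h
      simp only [add_im, one_im, mul_im, ofReal_re, I_im, ofReal_im, I_re, mul_one, mul_zero, add_zero, zero_add] at this
      linarith
    have hz := (differentiableAt_riemannZeta hne).hasDerivAt
    have hin : HasDerivAt (fun x : ℝ => 1 + ((2 * (b j + x * (a j - b j)) : ℝ) : ℂ) * I) ((2 * (a j - b j) : ℝ) * I) x := by
      have h1 : HasDerivAt (fun x : ℝ => 2 * (b j + x * (a j - b j))) (2 * (a j - b j)) x := by
        simpa using (((hasDerivAt_id x).mul_const (a j - b j)).const_add (b j)).const_mul 2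
      exact (h1.ofReal_comp.mul_const I).const_add 1
    exact hz.comp x hin
  · exact riemannZeta_ne_zero_of_one_le_re (by simp)
  · intro x hx
    have h7 := hpath x hx
    set u := 2 * (b j + x * (a j - b j)) with hu
    have hne : riemannZeta (1 + (u : ℂ) * I) ≠ 0 := riemannZeta_ne_zero_of_one_le_re (by simp)
    have h8 := hT0 u (by linarith)
    rw [norm_div, div_le_iff₀ (norm_pos_iff.mpr hne)] at h8
    rw [norm_mul, norm_mul, Complex.norm_I, mul_one, Complex.norm_real, Real.norm_eq_abs]
    have hLu1 : L ≤ Real.log u := Real.log_le_log (by linarith) h7.1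
    have hLu2 : Real.log u ≤ 2 * L := by
      have := Real.log_le_log (by linarith) h7.2
      have e4 : Real.log (4 * r j) = Real.log 4 + Real.log (r j) := Real.log_mul (by norm_num) (by linarith)
      rw [e4] at this
      have h4 : Real.log 4 ≤ 2 := by
        have : (4 : ℝ) = 2 ^ 2 := by norm_num
        rw [this, Real.log_pow]; push_cast; linarith [Real.log_two_lt_d9]
      linarith
    have hlu : l ≤ Real.log (Real.log u) := Real.log_le_log (by linarith) hLu1
    have hab : |2 * (a j - b j)| ≤ 4 * ω j := by rw [abs_le]; constructor <;> linarith
    have hq : Real.log u / Real.log (Real.log u) ≤ 2 * L / l := by gcongr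
    have hnn : 0 ≤ Real.log u / Real.log (Real.log u) := div_nonneg (by linarith) (by linarith)
    have hnn2 := mul_nonneg (mul_nonneg hK.le hnn) (norm_nonneg (riemannZeta (1 + (u : ℂ) * I)))
    calc ‖deriv riemannZeta (1 + (u : ℂ) * I)‖ * |2 * (a j - b j)|
        ≤ (K * (Real.log u / Real.log (Real.log u)) * ‖riemannZeta (1 + (u : ℂ) * I)‖) * (4 * ω j) := mul_le_mul h8 hab (abs_nonneg _) hnn2
      _ ≤ (K * (2 * L / l) * ‖riemannZeta (1 + (u : ℂ) * I)‖) * (4 * ω j) := by gcongr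
      _ = _ := by ring

lemma gsum_aux (N : ℕ) : ∑ j ∈ Finset.range N, 2 / ((j : ℝ) ^ 2 + 1) ≤ 10 := by
  have key : ∀ n : ℕ, ∑ j ∈ Finset.range (n + 1), 2 / ((j : ℝ) ^ 2 + 1) ≤ 10 - 4 / ((n : ℝ) + 1) := by
    intro n
    induction n with
    | zero => norm_num
    | succ n ih =>
      rw [Finset.sum_range_succ]
      have h : 2 / (((n + 1 : ℕ) : ℝ) ^ 2 + 1) ≤ 4 / ((n : ℝ) + 1) - 4 / (((n + 1 : ℕ) : ℝ) + 1) := by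
        push_cast
        have hn : (0 : ℝ) ≤ n := Nat.cast_nonneg n
        rw [div_sub_div _ _ (by positivity) (by positivity), div_le_div_iff₀ (by positivity) (by positivity)]
        nlinarith
      linarith
  rcases N with _ | n
  · simp
  · have := key n
    have h2 : 0 ≤ 4 / ((n : ℝ) + 1) := by positivity
    linarith

lemma gsum_bound (x : ℝ) (hx : 1 ≤ x) (N : ℕ) :
    |∑ j ∈ Finset.range N, ((j : ℝ) + 1 / 2) / (((j : ℝ) + 1 / 2) ^ 2 + x ^ 2) -
      1 / 2 * (Real.log ((N : ℝ) ^ 2 + x ^ 2) - Real.log (x ^ 2))| ≤ 10 := by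
  refine le_trans ?_ (gsum_aux N)
  induction N with
  | zero => simp
  | succ n ih =>
    rw [Finset.sum_range_succ, Finset.sum_range_succ]
    set S := ∑ j ∈ Finset.range n, ((j : ℝ) + 1 / 2) / (((j : ℝ) + 1 / 2) ^ 2 + x ^ 2)
    set q0 := (n : ℝ) ^ 2 + x ^ 2 with hq0
    set q1 := ((n + 1 : ℕ) : ℝ) ^ 2 + x ^ 2 with hq1
    have hn : (0 : ℝ) ≤ n := Nat.cast_nonneg n
    have p0 : 0 < q0 := by positivity
    have p1 : 0 < q1 := by positivity
    set a := (n : ℝ) + 1 / 2 with ha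
    have ha0 : 0 < a := by positivity
    have hq : q1 - q0 = 2 * a := by rw [hq1, hq0, ha]; push_cast; ring
    set qm := a ^ 2 + x ^ 2 with hqm
    have pm : 0 < qm := by positivity
    have m0 : q0 ≤ qm := by rw [hq0, hqm, ha]; nlinarith
    have m1 : qm ≤ q1 := by rw [hq1, hqm, ha]; push_cast; nlinarith
    have l1 : 1 / 2 * (Real.log q1 - Real.log q0) ≤ a / q0 := by
      rw [← Real.log_div p1.ne' p0.ne']
      have := Real.log_le_sub_one_of_pos (div_pos p1 p0)
      have e : q1 / q0 - 1 = 2 * (a / q0) := by rw [← mul_div_assoc, ← hq]; field_simp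
      linarith
    have l2 : a / q1 ≤ 1 / 2 * (Real.log q1 - Real.log q0) := by
      have := Real.log_le_sub_one_of_pos (div_pos p0 p1)
      rw [Real.log_div p0.ne' p1.ne'] at this
      have e : q0 / q1 - 1 = -(2 * (a / q1)) := by rw [← mul_div_assoc, ← hq]; field_simp; ring
      linarith
    have l3 : a / qm ≤ a / q0 := by gcongr
    have l4 : a / q1 ≤ a / qm := by gcongr
    have l5 : a / q0 - a / q1 ≤ 2 / ((n : ℝ) ^ 2 + 1) := by
      have e : a / q0 - a / q1 = a * (2 * a) / (q0 * q1) := by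
        rw [← hq]; field_simp
      rw [e, div_le_div_iff₀ (by positivity) (by positivity)]
      have h1 : a ^ 2 ≤ q1 := by nlinarith
      have h2 : (n : ℝ) ^ 2 + 1 ≤ q0 := by rw [hq0]; nlinarith
      calc a * (2 * a) * ((n : ℝ) ^ 2 + 1) = 2 * (((n : ℝ) ^ 2 + 1) * a ^ 2) := by ring
        _ ≤ 2 * (q0 * q1) := by gcongr
    have e : S + a / qm - 1 / 2 * (Real.log q1 - Real.log (x ^ 2)) =
      (S - 1 / 2 * (Real.log q0 - Real.log (x ^ 2))) + (a / qm - 1 / 2 * (Real.log q1 - Real.log q0)) := by ring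
    rw [e]
    refine (abs_add_le _ _).trans ?_
    have : |a / qm - 1 / 2 * (Real.log q1 - Real.log q0)| ≤ 2 / ((n : ℝ) ^ 2 + 1) := by
      rw [abs_le]; constructor <;> linarith
    linarith

/-- the derivative factor -/
noncomputable def gS (n : ℕ) (x : ℝ) : ℝ :=
  Real.log n - ∑ j ∈ Finset.range (n + 1), ((j : ℝ) + 1 / 2) / (((j : ℝ) + 1 / 2) ^ 2 + x ^ 2)

lemma gS_bound (n : ℕ) (x r : ℝ) (hr : 2 ≤ r) (h1 : r / 2 ≤ x) (h2 : x ≤ 2 * r) (hn : 2 * r ≤ n) :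
    |gS n x - Real.log r| ≤ 12 := by
  have hx : 1 ≤ x := by linarith
  have hx0 : 0 < x := by linarith
  have hb := abs_le.mp (gsum_bound x hx (n + 1))
  have hn1 : (4 : ℝ) ≤ n := by linarith
  have hl2 : Real.log 2 ≤ 0.7 := by linarith [Real.log_two_lt_d9]
  have e1 : Real.log (x ^ 2) = 2 * Real.log x := by rw [Real.log_pow]; norm_num
  have e2 : Real.log ((n : ℝ) ^ 2) = 2 * Real.log n := by rw [Real.log_pow]; norm_num
  have u1 : 2 * Real.log n ≤ Real.log (((n + 1 : ℕ) : ℝ) ^ 2 + x ^ 2) := by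
    rw [← e2]; apply Real.log_le_log (by positivity); push_cast; nlinarith
  have u2 : Real.log (((n + 1 : ℕ) : ℝ) ^ 2 + x ^ 2) ≤ 2 * Real.log n + 2 * Real.log 2 := by
    have : 2 * Real.log n + 2 * Real.log 2 = Real.log (4 * (n : ℝ) ^ 2) := by
      rw [Real.log_mul (by norm_num) (by positivity), e2]
      have : (4 : ℝ) = 2 ^ 2 := by norm_num
      rw [this, Real.log_pow]; push_cast; ring
    rw [this]
    apply Real.log_le_log (by positivity); push_cast; nlinarith
  have v1 : Real.log r - Real.log 2 ≤ Real.log x := by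
    rw [← Real.log_div (by linarith) (by norm_num)]
    exact Real.log_le_log (by linarith) h1
  have v2 : Real.log x ≤ Real.log 2 + Real.log r := by
    rw [← Real.log_mul (by norm_num) (by linarith)]
    exact Real.log_le_log hx0 h2
  rw [e1] at hb
  rw [gS, abs_le]
  constructor <;> linarith [hb.1, hb.2]

lemma gprod_deriv (N : ℕ) (x : ℝ) :
    HasDerivAt (fun x : ℝ => ∏ j ∈ Finset.range N, (((j : ℝ) + 1 / 2 : ℝ) - I * x) / (((j : ℝ) + 1 / 2 : ℝ) + I * x))
      ((∏ j ∈ Finset.range N, (((j : ℝ) + 1 / 2 : ℝ) - I * x) / (((j : ℝ) + 1 / 2 : ℝ) + I * x)) *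
        (-2 * I * ((∑ j ∈ Finset.range N, ((j : ℝ) + 1 / 2) / (((j : ℝ) + 1 / 2) ^ 2 + x ^ 2) : ℝ) : ℂ))) x := by
  induction N with
  | zero => simpa using hasDerivAt_const x (1 : ℂ)
  | succ n ih =>
    simp only [Finset.prod_range_succ]
    set a : ℝ := (n : ℝ) + 1 / 2 with ha
    have ha0 : 0 < a := by positivity
    have hp : (a : ℂ) + I * x ≠ 0 := by
      intro h; have := congrArg Complex.re h; simp at this; linarith
    have hm : (a : ℂ) - I * x ≠ 0 := by
      intro h; have := congrArg Complex.re h; simp at this; linarith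
    have hx : HasDerivAt (fun x : ℝ => I * (x : ℂ)) I x := by
      simpa using (hasDerivAt_id x).ofReal_comp.const_mul I
    have hu := (hx.const_sub (a : ℂ)).div (hx.const_add (a : ℂ)) hp
    refine (ih.mul hu).congr_deriv ?_
    have hsq : ((a : ℂ) + I * x) * ((a : ℂ) - I * x) = ((a ^ 2 + x ^ 2 : ℝ) : ℂ) := by
      push_cast; ring_nf; rw [I_sq]; ring
    rw [Finset.sum_range_succ]
    set P := ∏ j ∈ Finset.range n, (((j : ℝ) + 1 / 2 : ℝ) - I * x) / (((j : ℝ) + 1 / 2 : ℝ) + I * x)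
    rw [← ha]
    generalize (∑ j ∈ Finset.range n, ((j : ℝ) + 1 / 2) / (((j : ℝ) + 1 / 2) ^ 2 + x ^ 2) : ℝ) = S
    clear_value a P
    have hc : ((S + a / (a ^ 2 + x ^ 2) : ℝ) : ℂ) = (S : ℂ) + a / (((a : ℂ) + I * x) * ((a : ℂ) - I * x)) := by
      rw [Complex.ofReal_add, Complex.ofReal_div, ← hsq]
    rw [hc]
    simp only [Pi.div_apply]
    field_simp
    ring

lemma gamma_seq_ratio (n : ℕ) (hn : 1 ≤ n) (x : ℝ) :
    GammaSeq (1 / 2 + I * x) n / GammaSeq (1 / 2 - I * x) n =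
      cexp (2 * I * x * Real.log n) *
        ∏ j ∈ Finset.range (n + 1), (((j : ℝ) + 1 / 2 : ℝ) - I * x) / (((j : ℝ) + 1 / 2 : ℝ) + I * x) := by
  have hn0 : (n : ℂ) ≠ 0 := by exact_mod_cast (by omega : n ≠ 0)
  have hf : (n.factorial : ℂ) ≠ 0 := by exact_mod_cast n.factorial_ne_zero
  rw [GammaSeq, GammaSeq, Finset.prod_div_distrib]
  have e1 : ∏ j ∈ Finset.range (n + 1), ((1 : ℂ) / 2 + I * x + j) =
      ∏ j ∈ Finset.range (n + 1), ((((j : ℝ) + 1 / 2 : ℝ) : ℂ) + I * x) := by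
    apply Finset.prod_congr rfl; intro j _; push_cast; ring
  have e2 : ∏ j ∈ Finset.range (n + 1), ((1 : ℂ) / 2 - I * x + j) =
      ∏ j ∈ Finset.range (n + 1), ((((j : ℝ) + 1 / 2 : ℝ) : ℂ) - I * x) := by
    apply Finset.prod_congr rfl; intro j _; push_cast; ring
  rw [e1, e2]
  have e3 : (n : ℂ) ^ (1 / 2 + I * x : ℂ) = (n : ℂ) ^ (1 / 2 - I * x : ℂ) * cexp (2 * I * x * Real.log n) := by
    rw [Complex.cpow_def_of_ne_zero hn0, Complex.cpow_def_of_ne_zero hn0, ← Complex.exp_add]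
    congr 1
    rw [← Complex.natCast_log]
    ring
  rw [e3]
  have h3 : (n : ℂ) ^ (1 / 2 - I * x : ℂ) ≠ 0 := by
    rw [Complex.cpow_ne_zero_iff]; left; exact hn0
  have hP : ∏ j ∈ Finset.range (n + 1), ((((j : ℝ) + 1 / 2 : ℝ) : ℂ) + I * x) ≠ 0 := by
    rw [Finset.prod_ne_zero_iff]; intro j _ h
    have := congrArg Complex.re h
    simp at this
    have : (0 : ℝ) ≤ j := Nat.cast_nonneg j
    linarith
  have hQ : ∏ j ∈ Finset.range (n + 1), ((((j : ℝ) + 1 / 2 : ℝ) : ℂ) - I * x) ≠ 0 := by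
    rw [Finset.prod_ne_zero_iff]; intro j _ h
    have := congrArg Complex.re h
    simp at this
    have : (0 : ℝ) ≤ j := Nat.cast_nonneg j
    linarith
  generalize (n : ℂ) ^ (1 / 2 - I * x : ℂ) = y at *
  generalize (∏ j ∈ Finset.range (n + 1), ((((j : ℝ) + 1 / 2 : ℝ) : ℂ) + I * x)) = P at *
  generalize (∏ j ∈ Finset.range (n + 1), ((((j : ℝ) + 1 / 2 : ℝ) : ℂ) - I * x)) = Q at *
  generalize cexp (2 * I * x * Real.log n) = E
  field_simp

lemma gamma_fin_bound (n : ℕ) (hn1 : 1 ≤ n) (r a b : ℝ) (hr : 2 ≤ r) (ha1 : r / 2 ≤ a) (ha2 : a ≤ 2 * r)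
    (hb1 : r / 2 ≤ b) (hb2 : b ≤ 2 * r) (hn : 2 * r ≤ n) :
    ‖GammaSeq (1 / 2 + I * b) n / GammaSeq (1 / 2 - I * b) n * cexp (-(2 * I * b * Real.log r)) -
      GammaSeq (1 / 2 + I * a) n / GammaSeq (1 / 2 - I * a) n * cexp (-(2 * I * a * Real.log r))‖ ≤ 24 * |b - a| := by
  rw [gamma_seq_ratio n hn1, gamma_seq_ratio n hn1]
  set V : ℝ → ℂ := fun x => cexp (2 * I * x * Real.log n) *
        (∏ j ∈ Finset.range (n + 1), (((j : ℝ) + 1 / 2 : ℝ) - I * x) / (((j : ℝ) + 1 / 2 : ℝ) + I * x)) *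
        cexp (-(2 * I * x * Real.log r)) with hV
  have hVd : ∀ x, HasDerivAt V (V x * (2 * I * ((gS n x - Real.log r : ℝ) : ℂ))) x := by
    intro x
    have hx : ∀ c : ℂ, HasDerivAt (fun x : ℝ => 2 * I * (x : ℂ) * c) (2 * I * c) x := by
      intro c
      have := ((hasDerivAt_id x).ofReal_comp.const_mul (2 * I)).mul_const c
      simpa using this
    have h := ((hx (Real.log n)).cexp.mul (gprod_deriv (n + 1) x)).mul (hx (Real.log r)).neg.cexp
    refine h.congr_deriv ?_
    simp only [hV, gS, Pi.mul_apply, Pi.neg_apply]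
    generalize (∏ j ∈ Finset.range (n + 1), (((j : ℝ) + 1 / 2 : ℝ) - I * (x : ℂ)) / (((j : ℝ) + 1 / 2 : ℝ) + I * (x : ℂ))) = P
    generalize (∑ j ∈ Finset.range (n + 1), ((j : ℝ) + 1 / 2) / (((j : ℝ) + 1 / 2) ^ 2 + x ^ 2) : ℝ) = S
    simp only [Complex.ofReal_sub]
    ring
  have hV1 : ∀ x, ‖V x‖ = 1 := by
    intro x
    simp only [hV]
    have e1 : (2 * I * x * Real.log n : ℂ) = ((2 * x * Real.log n : ℝ) : ℂ) * I := by push_cast; ring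
    have e2 : (-(2 * I * x * Real.log r) : ℂ) = ((-(2 * x * Real.log r) : ℝ) : ℂ) * I := by push_cast; ring
    rw [norm_mul, norm_mul, e1, e2, Complex.norm_exp_ofReal_mul_I, Complex.norm_exp_ofReal_mul_I, norm_prod]
    rw [Finset.prod_eq_one, one_mul, one_mul]
    intro j _
    set c : ℝ := (j : ℝ) + 1 / 2 with hc
    have hp : (c : ℂ) + I * x ≠ 0 := by
      intro h; have := congrArg Complex.re h; simp at this
      have : 0 < c := by positivity
      linarith
    have : (c : ℂ) - I * x = (starRingEnd ℂ) (c + I * x) := by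
      simp [Complex.conj_ofReal]; ring
    rw [norm_div, this, RCLike.norm_conj, div_self (norm_ne_zero_iff.mpr hp)]
  have hconv : Convex ℝ (Set.Icc (r / 2) (2 * r)) := convex_Icc _ _
  have := hconv.norm_image_sub_le_of_norm_hasDerivWithin_le (f := V)
    (f' := fun x => V x * (2 * I * ((gS n x - Real.log r : ℝ) : ℂ))) (C := 24)
    (fun x _ => (hVd x).hasDerivWithinAt) (fun x hx => by
      rw [norm_mul, hV1, norm_mul, norm_mul, Complex.norm_real, Complex.norm_I, Real.norm_eq_abs]
      have := gS_bound n x r hr hx.1 hx.2 hn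
      simp only [Complex.norm_ofNat]
      linarith) ⟨ha1, ha2⟩ ⟨hb1, hb2⟩
  simpa [hV] using this

lemma gamma_bound (r a b : ℝ) (hr : 2 ≤ r) (ha1 : r / 2 ≤ a) (ha2 : a ≤ 2 * r)
    (hb1 : r / 2 ≤ b) (hb2 : b ≤ 2 * r) :
    ‖Complex.Gamma (1 / 2 + I * b) / Complex.Gamma (1 / 2 - I * b) * cexp (-(2 * I * b * Real.log r)) -
      Complex.Gamma (1 / 2 + I * a) / Complex.Gamma (1 / 2 - I * a) * cexp (-(2 * I * a * Real.log r))‖ ≤ 24 * |b - a| := by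
  have hne : ∀ x : ℝ, Complex.Gamma (1 / 2 - I * x) ≠ 0 := by
    intro x
    apply Complex.Gamma_ne_zero_of_re_pos
    simp
  have ht := (((GammaSeq_tendsto_Gamma (1 / 2 + I * b)).div (GammaSeq_tendsto_Gamma (1 / 2 - I * b)) (hne b)).mul_const
    (cexp (-(2 * I * b * Real.log r)))).sub
    (((GammaSeq_tendsto_Gamma (1 / 2 + I * a)).div (GammaSeq_tendsto_Gamma (1 / 2 - I * a)) (hne a)).mul_const
    (cexp (-(2 * I * a * Real.log r))))
  refine le_of_tendsto ht.norm ?_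
  filter_upwards [eventually_ge_atTop 1, (tendsto_natCast_atTop_atTop (R := ℝ)).eventually_ge_atTop (2 * r)] with n h1 h2
  exact gamma_fin_bound n h1 r a b hr ha1 ha2 hb1 hb2 h2

theorem zeta_gamma_phase_asymptotic
    (r ω r' r'' : ℕ → ℝ)
    (hr : Tendsto r atTop atTop)
    (hωpos : ∀ j, 0 < ω j)
    (hω : Tendsto (fun j => ω j * Real.log (r j) / Real.log (Real.log (r j)))
      atTop (𝓝 0))
    (hr' : ∀ j, |r' j - r j| < ω j)
    (hr'' : ∀ j, |r'' j - r j| < ω j) :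
    Tendsto (fun j =>
        riemannZeta (1 + 2 * Complex.I * (r' j : ℂ)) *
            riemannZeta (1 - 2 * Complex.I * (r'' j : ℂ)) *
            Complex.Gamma (1 / 2 + Complex.I * (r' j : ℂ)) *
            Complex.Gamma (1 / 2 - Complex.I * (r'' j : ℂ)) /
          (riemannZeta (1 + 2 * Complex.I * (r'' j : ℂ)) *
            riemannZeta (1 - 2 * Complex.I * (r' j : ℂ)) *
            Complex.Gamma (1 / 2 + Complex.I * (r'' j : ℂ)) *
            Complex.Gamma (1 / 2 - Complex.I * (r' j : ℂ))) -
        Complex.exp (2 * Complex.I * ((r' j : ℂ) - (r'' j : ℂ)) *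
          (Real.log (r j) : ℂ)))
      atTop (𝓝 0) := by
  have hω0 := omega_facts r ω hr hωpos hω
  have hz1 := zeta_ratio r ω r' r'' hr hωpos hω hr' hr''
  have hz2' := zeta_ratio r ω r'' r' hr hωpos hω hr'' hr'
  have hz2 : Tendsto (fun j => riemannZeta (1 - 2 * I * (r'' j : ℂ)) / riemannZeta (1 - 2 * I * (r' j : ℂ)))
      atTop (𝓝 1) := by
    have h := (Complex.continuous_conj.tendsto (1 : ℂ)).comp hz2'
    rw [map_one] at h
    refine h.congr fun j => ?_
    have hc : ∀ x : ℝ, (starRingEnd ℂ) (riemannZeta (1 + 2 * I * (x : ℂ))) = riemannZeta (1 - 2 * I * (x : ℂ)) := by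
      intro x
      rw [← riemannZeta_conj]
      congr 1
      apply Complex.ext <;> simp
    simp only [Function.comp_apply, map_div₀, hc]
  have hgne : ∀ x : ℝ, Complex.Gamma (1 / 2 - I * x) ≠ 0 := by
    intro x
    apply Complex.Gamma_ne_zero_of_re_pos
    simp
  have hgne' : ∀ x : ℝ, Complex.Gamma (1 / 2 + I * x) ≠ 0 := by
    intro x
    apply Complex.Gamma_ne_zero_of_re_pos
    simp
  have hg1 : ∀ x : ℝ, ‖Complex.Gamma (1 / 2 + I * x) / Complex.Gamma (1 / 2 - I * x)‖ = 1 := by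
    intro x
    have : (1 / 2 - I * x : ℂ) = (starRingEnd ℂ) (1 / 2 + I * x) := by
      apply Complex.ext <;> simp
    rw [norm_div, this, Complex.Gamma_conj, RCLike.norm_conj, div_self (norm_ne_zero_iff.mpr (hgne' x))]
  set g : ℝ → ℂ := fun x => Complex.Gamma (1 / 2 + I * x) / Complex.Gamma (1 / 2 - I * x) with hg
  have hg0 : ∀ x, g x ≠ 0 := fun x => norm_ne_zero_iff.mp (by rw [hg1 x]; exact one_ne_zero)
  have hGn : ∀ j, ‖g (r' j) / g (r'' j)‖ = 1 := by
    intro j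
    rw [norm_div, hg1, hg1, div_one]
  have hGE : Tendsto (fun j => g (r' j) / g (r'' j) -
      cexp (2 * I * ((r' j : ℂ) - (r'' j : ℂ)) * (Real.log (r j) : ℂ))) atTop (𝓝 0) := by
    have hlim : Tendsto (fun j => 48 * ω j) atTop (𝓝 0) := by simpa using hω0.const_mul 48
    refine squeeze_zero_norm' ?_ hlim
    filter_upwards [hr.eventually_ge_atTop 10, hω0.eventually_le_const (show (0 : ℝ) < 1 by norm_num)] with j h1 h2
    have h3 := abs_lt.mp (hr' j)
    have h4 := abs_lt.mp (hr'' j)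
    have hb := gamma_bound (r j) (r'' j) (r' j) (by linarith) (by linarith) (by linarith) (by linarith) (by linarith)
    have habs : |r' j - r'' j| ≤ 2 * ω j := by
      rw [abs_le]
      constructor <;> linarith
    have hE : ‖cexp (2 * I * (r' j : ℂ) * Real.log (r j))‖ = 1 := by
      have : (2 * I * (r' j : ℂ) * Real.log (r j) : ℂ) = ((2 * r' j * Real.log (r j) : ℝ) : ℂ) * I := by
        push_cast
        ring
      rw [this, Complex.norm_exp_ofReal_mul_I]
    have key : g (r' j) / g (r'' j) - cexp (2 * I * ((r' j : ℂ) - (r'' j : ℂ)) * (Real.log (r j) : ℂ)) =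
        (g (r' j) * cexp (-(2 * I * (r' j : ℂ) * Real.log (r j))) -
          g (r'' j) * cexp (-(2 * I * (r'' j : ℂ) * Real.log (r j)))) *
          cexp (2 * I * (r' j : ℂ) * Real.log (r j)) / g (r'' j) := by
      have e1 : cexp (2 * I * ((r' j : ℂ) - (r'' j : ℂ)) * (Real.log (r j) : ℂ)) =
          cexp (-(2 * I * (r'' j : ℂ) * Real.log (r j))) * cexp (2 * I * (r' j : ℂ) * Real.log (r j)) := by
        rw [← Complex.exp_add]
        congr 1
        ring
      have e2 : cexp (-(2 * I * (r' j : ℂ) * Real.log (r j))) * cexp (2 * I * (r' j : ℂ) * Real.log (r j)) = 1 := by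
        rw [← Complex.exp_add, neg_add_cancel, Complex.exp_zero]
      rw [e1, eq_div_iff (hg0 _), sub_mul, div_mul_cancel₀ _ (hg0 _), sub_mul, mul_assoc (g (r' j)), e2]
      ring
    rw [key, norm_div, norm_mul, hE, hg1, mul_one, div_one]
    refine hb.trans ?_
    linarith
  have hz := hz1.mul hz2
  rw [mul_one] at hz
  have hz0 := hz.sub_const 1
  rw [sub_self] at hz0
  have hmain : Tendsto (fun j => (riemannZeta (1 + 2 * I * (r' j : ℂ)) / riemannZeta (1 + 2 * I * (r'' j : ℂ)) *
      (riemannZeta (1 - 2 * I * (r'' j : ℂ)) / riemannZeta (1 - 2 * I * (r' j : ℂ))) - 1) * (g (r' j) / g (r'' j)))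
      atTop (𝓝 0) := by
    rw [tendsto_zero_iff_norm_tendsto_zero] at hz0 ⊢
    refine hz0.congr fun j => ?_
    rw [norm_mul, hGn, mul_one]
  have hfin := hmain.add hGE
  rw [add_zero] at hfin
  refine hfin.congr fun j => ?_
  have e : g (r' j) / g (r'' j) = Complex.Gamma (1 / 2 + I * (r' j : ℂ)) * Complex.Gamma (1 / 2 - I * (r'' j : ℂ)) /
      (Complex.Gamma (1 / 2 + I * (r'' j : ℂ)) * Complex.Gamma (1 / 2 - I * (r' j : ℂ))) := by
    simp only [hg]
    rw [div_div_div_eq]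
    congr 1
    ring
  rw [e]
  simp only [div_eq_mul_inv, mul_inv]
  ring
end

section
/- Let (r_j) be a sequence of reals tending to +∞ and let (h_j) be a sequence of nonnegative integrable functions on ℝ with ∫_ℝ h_j(r) dr = 1 for all j and ∫_ℝ h_j(r) |r − r_j| dr → 0 as j → ∞. Then there exist a sequence of positive reals (ω̃_j) with ω̃_j → 0 and a sequence of smooth functions (h̃_j) on ℝ, each compactly supported in [r_j − ω̃_j, r_j + ω̃_j], with ∫_ℝ h̃_j(r) dr = 1 and ∫_ℝ |h_j(r) − h̃_j(r)| dr → 0 as j → ∞. -/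
open Filter Topology MeasureTheory

/-- Smooth truncation of a single density at scale `w`, with explicit error. -/
theorem aux_single (c w d : ℝ) (hw : 0 < w) (hd : 0 < d) (h : ℝ → ℝ)
    (hint : Integrable h) (hnonneg : ∀ x, 0 ≤ h x) (hmass : ∫ x, h x = 1)
    (hmomint : Integrable (fun x => h x * |x - c|)) :
    ∃ g : ℝ → ℝ, ContDiff ℝ (⊤ : ℕ∞) g ∧ tsupport g ⊆ Set.Icc (c - w) (c + w) ∧
      ∫ x, g x = 1 ∧
      ∫ x, |h x - g x| ≤ 2 * (2 / w * (∫ x, h x * |x - c|) + d) := by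
  obtain ⟨f, hfc, hfs, hfn⟩ := (memLp_one_iff_integrable.2 hint).exist_eLpNorm_sub_le
    ENNReal.one_ne_top le_rfl hd
  have hfi : Integrable f := hfs.continuous.integrable_of_hasCompactSupport hfc
  have hfd : ∫ x, |h x - f x| ≤ d := by
    rw [eLpNorm_one_eq_lintegral_enorm,
      ← ofReal_integral_norm_eq_lintegral_enorm (hint.sub hfi),
      ENNReal.ofReal_le_ofReal_iff hd.le] at hfn
    simpa [Real.norm_eq_abs] using hfn
  let b : ContDiffBump c := ⟨w / 2, w, by positivity, by linarith⟩
  have hbs : tsupport b = Set.Icc (c - w) (c + w) := by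
    rw [b.tsupport_eq, Real.closedBall_eq_Icc]
  have hbn : tsupport (b.normed volume) = Set.Icc (c - w) (c + w) := by
    rw [b.tsupport_normed_eq, Real.closedBall_eq_Icc]
  let k : ℝ → ℝ := fun x => b x * f x
  have hks : ContDiff ℝ (⊤ : ℕ∞) k := b.contDiff.mul hfs
  have hki : Integrable k :=
    hks.continuous.integrable_of_hasCompactSupport (b.hasCompactSupport.mul_right)
  have hI : Integrable (fun x => |h x - f x|) := (hint.sub hfi).abs
  have hkd : ∫ x, |h x - k x| ≤ 2 / w * (∫ x, h x * |x - c|) + d := by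
    calc ∫ x, |h x - k x| ≤ ∫ x, (2 / w * (h x * |x - c|) + |h x - f x|) := by
          refine integral_mono (hint.sub hki).abs ((hmomint.const_mul _).add hI) fun x => ?_
          have h0 := b.nonneg' x
          have h1 : b x ≤ 1 := b.le_one
          have e : h x - k x = (1 - b x) * h x + b x * (h x - f x) := by
            simp only [k]; ring
          have e1 : 1 - b x ≤ 2 / w * |x - c| := by
            by_cases hx : |x - c| ≤ w / 2
            · have : b x = 1 := b.one_of_mem_closedBall (by
                simpa [Metric.mem_closedBall, Real.dist_eq, b] using hx)
              rw [this, sub_self]; positivity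
            · push Not at hx
              have : 1 ≤ 2 / w * |x - c| := by
                rw [div_mul_eq_mul_div, le_div_iff₀ hw]; linarith
              linarith
          have e2 : (1 - b x) * h x ≤ 2 / w * (h x * |x - c|) := by
            have := mul_le_mul_of_nonneg_right e1 (hnonneg x)
            linarith
          have e3 : b x * |h x - f x| ≤ |h x - f x| :=
            mul_le_of_le_one_left (abs_nonneg _) h1
          show |h x - k x| ≤ 2 / w * (h x * |x - c|) + |h x - f x|
          rw [e]
          refine (abs_add_le _ _).trans ?_
          rw [abs_mul, abs_mul, abs_of_nonneg (hnonneg x), abs_of_nonneg h0,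
            abs_of_nonneg (sub_nonneg.2 h1)]
          linarith
      _ = 2 / w * (∫ x, h x * |x - c|) + ∫ x, |h x - f x| := by
          rw [integral_add (hmomint.const_mul _) hI, integral_const_mul]
      _ ≤ _ := by linarith
  have hm : |1 - ∫ x, k x| ≤ ∫ x, |h x - k x| := by
    rw [← hmass, ← integral_sub hint hki]
    exact abs_integral_le_integral_abs
  have hni : Integrable (b.normed volume) := b.integrable_normed
  let m : ℝ := 1 - ∫ x, k x
  refine ⟨fun x => k x + m * b.normed volume x, ?_, ?_, ?_, ?_⟩
  · exact hks.add (contDiff_const.mul b.contDiff_normed)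
  · refine closure_minimal (fun x hx => ?_) isClosed_Icc
    by_contra hc
    have z1 : b x = 0 := image_eq_zero_of_notMem_tsupport (by rwa [hbs])
    have z2 : b.normed volume x = 0 := image_eq_zero_of_notMem_tsupport (by rwa [hbn])
    exact hx (by simp [k, z1, z2])
  · rw [integral_add hki (hni.const_mul m), integral_const_mul, b.integral_normed]
    simp only [m]; ring
  · calc ∫ x, |h x - (k x + m * b.normed volume x)|
        ≤ ∫ x, (|h x - k x| + |m| * b.normed volume x) := by
          refine integral_mono (hint.sub (hki.add (hni.const_mul m))).abs
            ((hint.sub hki).abs.add (hni.const_mul _)) fun x => ?_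
          show |h x - (k x + m * b.normed volume x)| ≤ |h x - k x| + |m| * b.normed volume x
          have e : h x - (k x + m * b.normed volume x)
            = (h x - k x) - m * b.normed volume x := by ring
          rw [e]
          refine (abs_sub _ _).trans ?_
          rw [abs_mul, abs_of_nonneg (b.nonneg_normed x)]
      _ = (∫ x, |h x - k x|) + |m| := by
          have hJ : Integrable (fun x => |h x - k x|) := (hint.sub hki).abs
          rw [integral_add hJ (hni.const_mul _), integral_const_mul,
            b.integral_normed, mul_one]
      _ ≤ _ := by simp only [m]; linarith

theorem smooth_truncation_of_quasimode_densities
    (r : ℕ → ℝ) (h : ℕ → ℝ → ℝ)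
    (hr : Tendsto r atTop atTop)
    (hint : ∀ j, Integrable (h j))
    (hnonneg : ∀ j x, 0 ≤ h j x)
    (hmass : ∀ j, ∫ x, h j x = 1)
    (hmomint : ∀ j, Integrable (fun x => h j x * |x - r j|))
    (hmom : Tendsto (fun j => ∫ x, h j x * |x - r j|) atTop (𝓝 0)) :
    ∃ ω : ℕ → ℝ, (∀ j, 0 < ω j) ∧ Tendsto ω atTop (𝓝 0) ∧
      ∃ g : ℕ → ℝ → ℝ,
        (∀ j, ContDiff ℝ (⊤ : ℕ∞) (g j)) ∧
        (∀ j, tsupport (g j) ⊆ Set.Icc (r j - ω j) (r j + ω j)) ∧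
        (∀ j, ∫ x, g j x = 1) ∧
        Tendsto (fun j => ∫ x, |h j x - g j x|) atTop (𝓝 0) := by
  let a : ℕ → ℝ := fun j => ∫ x, h j x * |x - r j|
  have ha : ∀ j, 0 ≤ a j := fun j =>
    integral_nonneg fun x => mul_nonneg (hnonneg j x) (abs_nonneg _)
  let d : ℕ → ℝ := fun j => 1 / ((j : ℝ) + 1)
  have hd : ∀ j, 0 < d j := fun j => by positivity
  have hdt : Tendsto d atTop (𝓝 0) := tendsto_one_div_add_atTop_nhds_zero_nat
  have hst : Tendsto (fun j => √(a j)) atTop (𝓝 0) := by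
    have := (Real.continuous_sqrt.tendsto 0).comp hmom
    rw [Real.sqrt_zero] at this
    exact this
  have hw : ∀ j, 0 < √(a j) + d j := fun j => by
    have := hd j; positivity
  choose g hg1 hg2 hg3 hg4 using fun j => aux_single (r j) (√(a j) + d j) (d j) (hw j) (hd j)
    (h j) (hint j) (hnonneg j) (hmass j) (hmomint j)
  refine ⟨fun j => √(a j) + d j, hw, by simpa using hst.add hdt, g, hg1, hg2, hg3, ?_⟩
  have hlim : Tendsto (fun j => 2 * (2 * √(a j) + d j)) atTop (𝓝 0) := by
    simpa using ((hst.const_mul 2).add hdt).const_mul 2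
  refine squeeze_zero (fun j => integral_nonneg fun x => abs_nonneg _) (fun j => ?_) hlim
  refine (hg4 j).trans ?_
  have : 2 / (√(a j) + d j) * a j ≤ 2 * √(a j) := by
    rw [div_mul_eq_mul_div, div_le_iff₀ (hw j)]
    have e := Real.mul_self_sqrt (ha j)
    have := mul_nonneg (Real.sqrt_nonneg (a j)) (hd j).le
    nlinarith
  have h' : 2 / (√(a j) + d j) * (∫ x, h j x * |x - r j|) ≤ 2 * √(a j) := this
  linarith
end
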